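/- arXiv:2309.00103 — 2 statements merged into one kernel-verified Lean document; each statement's English description precedes it below -/
import Mathlib

section
/- Let d, n ≥ 1 be integers and let A_1, …, A_n and B_1, …, B_n be measurable subsets of positive measure of the torus T^d. For each i, let A'_i and B'_i be bands in T^d centred at the origin with |A'_i| = |A_i| and |B'_i| = |B_i|, i.e., sets of the form I × T^{d−1} where I is a closed interval in T centred at 0. Then for b_i chosen independently and uniformly at random from B_i, and b'_i chosen independently and uniformly at random from B'_i, one has E(|⋃_{i=1}^n (A_i + b_i)|) ≥ E(|⋃_{i=1}^n (A'_i + b'_i)|). -/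
open MeasureTheory

/-- The circle `ℝ/ℤ`. -/
abbrev 𝕋 := AddCircle (1 : ℝ)

/-- The expected (Haar) measure of `⋃ i, (A i + b i)` in the torus `𝕋^d`, where each `b i`
is chosen independently and uniformly at random from `B i`. -/
noncomputable def expUnionT {d n : ℕ} (A B : Fin n → Set (Fin d → 𝕋)) : ℝ :=
  ((∏ i, volume (B i))⁻¹ *
    ∫⁻ b in Set.univ.pi B, volume (⋃ i, (· + b i) '' (A i))).toReal

/-- The band `[-c, c] × 𝕋^d` in `𝕋^{d+1}`, centred at the origin. -/
def band (d : ℕ) (c : ℝ) : Set (Fin (d + 1) → 𝕋) :=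
  {x | x 0 ∈ (fun r : ℝ => (r : 𝕋)) '' Set.Icc (-c) c}

open scoped symmDiff

set_option linter.unusedSectionVars false

/-- The convolution of the indicator functions of `B` and `C`. -/
noncomputable def indConv {G : Type*} [AddCommGroup G] [MeasurableSpace G] (μ : Measure G)
    (B C : Set G) (x : G) : ℝ :=
  μ.real {y | y ∈ B ∧ x - y ∈ C}

section CompactGroup

variable {G : Type*} [AddCommGroup G] [TopologicalSpace G] [IsTopologicalAddGroup G]
  [MeasurableSpace G] [BorelSpace G] [SecondCountableTopology G]
  {μ : Measure G} [IsProbabilityMeasure μ] [μ.IsAddLeftInvariant] [μ.IsNegInvariant]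

lemma indConv_nonneg (B C : Set G) (x : G) : 0 ≤ indConv μ B C x := measureReal_nonneg

lemma indConv_le_left (B C : Set G) (x : G) : indConv μ B C x ≤ μ.real B :=
  measureReal_mono fun _ h => h.1

lemma measureReal_preimage_sub_left {C : Set G} (hC : MeasurableSet C) (x : G) :
    μ.real ((fun y => x - y) ⁻¹' C) = μ.real C :=
  (Measure.measurePreserving_sub_left μ x).measureReal_preimage hC.nullMeasurableSet

lemma indConv_le_right (B : Set G) {C : Set G} (hC : MeasurableSet C) (x : G) :
    indConv μ B C x ≤ μ.real C :=
  (measureReal_mono fun _ h => h.2).trans_eq (measureReal_preimage_sub_left hC x)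

lemma measurableSet_indConv {B C : Set G} (hB : MeasurableSet B) (hC : MeasurableSet C) (x : G) :
    MeasurableSet {y | y ∈ B ∧ x - y ∈ C} :=
  hB.inter ((measurable_const.sub measurable_id) hC)

lemma add_sub_one_le_indConv {B C : Set G} (hC : MeasurableSet C) (x : G) :
    μ.real B + μ.real C - 1 ≤ indConv μ B C x := by
  have h := measureReal_union_add_inter (μ := μ) (s := B) (t := (fun y => x - y) ⁻¹' C)
    ((measurable_const.sub measurable_id) hC)
  rw [measureReal_preimage_sub_left hC] at h
  have h1 : μ.real (B ∪ (fun y => x - y) ⁻¹' C) ≤ 1 := measureReal_le_one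
  have h2 : indConv μ B C x = μ.real (B ∩ (fun y => x - y) ⁻¹' C) := rfl
  linarith

lemma indConv_union_add_inter (B : Set G) {C C' : Set G} (hB : MeasurableSet B)
    (hC' : MeasurableSet C') (x : G) :
    indConv μ B (C ∪ C') x + indConv μ B (C ∩ C') x = indConv μ B C x + indConv μ B C' x := by
  have h := measureReal_union_add_inter (μ := μ) (s := {y | y ∈ B ∧ x - y ∈ C})
    (measurableSet_indConv hB hC' x)
  unfold indConv
  convert! h using 3 <;> ext y <;> simp

lemma indConv_mono (B : Set G) {C C' : Set G} (h : C ⊆ C') (x : G) :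
    indConv μ B C x ≤ indConv μ B C' x :=
  measureReal_mono fun _ hy => ⟨hy.1, h hy.2⟩

lemma lintegral_measure_conv {B C : Set G} (hB : MeasurableSet B) (hC : MeasurableSet C) :
    ∫⁻ x, μ {y | y ∈ B ∧ x - y ∈ C} ∂μ = μ B * μ C := by
  have hm : MeasurableSet {p : G × G | p.2 ∈ B ∧ p.1 - p.2 ∈ C} :=
    (measurable_snd hB).inter ((measurable_fst.sub measurable_snd) hC)
  have h1 := Measure.prod_apply (μ := μ) (ν := μ) hm
  have h2 := Measure.prod_apply_symm (μ := μ) (ν := μ) hm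
  have h3 : ∀ y, μ ((fun x => (x, y)) ⁻¹' {p : G × G | p.2 ∈ B ∧ p.1 - p.2 ∈ C})
      = B.indicator (fun _ => μ C) y := by
    intro y
    by_cases hy : y ∈ B
    · have := (measurePreserving_sub_right μ y).measure_preimage hC.nullMeasurableSet
      simp only [Set.preimage_ofPred_eq, hy, true_and, Set.indicator_of_mem]
      exact this
    · simp [hy]
  simp_rw [h3] at h2
  rw [lintegral_indicator hB, setLIntegral_const, h1] at h2
  rw [mul_comm, ← h2]
  rfl

lemma measurable_measure_conv {B C : Set G} (hB : MeasurableSet B) (hC : MeasurableSet C) :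
    Measurable fun x => μ {y | y ∈ B ∧ x - y ∈ C} :=
  measurable_measure_prodMk_left (s := {p : G × G | p.2 ∈ B ∧ p.1 - p.2 ∈ C})
    ((measurable_snd hB).inter ((measurable_fst.sub measurable_snd) hC))

lemma measurable_indConv {B C : Set G} (hB : MeasurableSet B) (hC : MeasurableSet C) :
    Measurable (indConv μ B C) :=
  (measurable_measure_conv hB hC).ennreal_toReal

lemma integral_indConv {B C : Set G} (hB : MeasurableSet B) (hC : MeasurableSet C) :
    ∫ x, indConv μ B C x ∂μ = μ.real B * μ.real C := by
  unfold indConv Measure.real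
  rw [integral_toReal (measurable_measure_conv hB hC).aemeasurable
    (.of_forall fun _ => measure_lt_top _ _), lintegral_measure_conv hB hC, ENNReal.toReal_mul]

lemma integrable_indConv {B C : Set G} (hB : MeasurableSet B) (hC : MeasurableSet C) :
    Integrable (indConv μ B C) μ :=
  .of_bound (measurable_indConv hB hC).aestronglyMeasurable (μ.real B)
    (.of_forall fun x => by
      rw [Real.norm_of_nonneg (indConv_nonneg B C x)]; exact indConv_le_left B C x)

lemma integrable_min_indConv {B C : Set G} (hB : MeasurableSet B) (hC : MeasurableSet C) (t : ℝ) :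
    Integrable (fun x => min (indConv μ B C x) t) μ :=
  (integrable_indConv hB hC).inf (integrable_const t)

lemma continuous_indConv [μ.InnerRegularCompactLTTop] (B : Set G) {C : Set G}
    (hC : MeasurableSet C) : Continuous (indConv μ B C) := by
  rw [continuous_iff_continuousAt]
  intro x₀
  let f : C(G, C(G, G)) := ContinuousMap.curry ⟨fun p => p.1 - p.2, by fun_prop⟩
  have h := tendsto_measure_symmDiff_preimage_nhds_zero (μ := μ) (ν := μ) (f := f) (g := f x₀)
    (s := C) (f.continuous.tendsto x₀)
    (.of_forall fun x => Measure.measurePreserving_sub_left μ x)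
    (Measure.measurePreserving_sub_left μ x₀) hC.nullMeasurableSet (measure_ne_top _ _)
  have h' := (ENNReal.tendsto_toReal ENNReal.zero_ne_top).comp h
  rw [ContinuousAt, tendsto_iff_dist_tendsto_zero]
  refine squeeze_zero (fun _ => dist_nonneg) (fun x => ?_) h'
  have key : ∀ x x', indConv μ B C x ≤ indConv μ B C x' + μ.real ((f x ⁻¹' C) ∆ (f x' ⁻¹' C)) := by
    intro x x'
    refine (measureReal_mono ?_).trans (measureReal_union_le _ _)
    intro y hy
    by_cases h : y ∈ f x' ⁻¹' C
    · exact .inl ⟨hy.1, h⟩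
    · exact .inr (.inl ⟨hy.2, h⟩)
  rw [Real.dist_eq, abs_sub_le_iff]
  have h1 := key x x₀
  have h2 := key x₀ x
  rw [symmDiff_comm] at h2
  simp only [Function.comp, Measure.real] at *
  constructor <;> linarith

/-- In a connected group, the overlap of `C` with its translates takes every value between
`μ(C)²` and `μ(C)`. -/
lemma exists_measureReal_inter_translate [PreconnectedSpace G] [μ.InnerRegularCompactLTTop]
    {C : Set G} (hC : MeasurableSet C) {r : ℝ} (h1 : μ.real C ^ 2 ≤ r) (h2 : r ≤ μ.real C) :
    ∃ y, μ.real (C ∩ (fun x => x - y) ⁻¹' C) = r := by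
  have hneg : MeasurableSet (-C) := hC.neg
  have heq : ∀ y, indConv μ C (-C) y = μ.real (C ∩ (fun x => x - y) ⁻¹' C) := by
    intro y
    unfold indConv
    congr 1
    ext x
    simp
  have hint := integral_indConv (μ := μ) hC hneg
  have hn : μ.real (-C) = μ.real C := by simp [Measure.real, Measure.measure_neg]
  obtain ⟨y₀, hy₀⟩ := exists_le_integral (integrable_indConv (μ := μ) hC hneg)
  rw [hint, hn, ← sq] at hy₀
  have h0 : indConv μ C (-C) 0 = μ.real C := by rw [heq]; simp
  obtain ⟨y, hy⟩ := intermediate_value_univ y₀ 0 (continuous_indConv (μ := μ) C hneg)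
    ⟨hy₀.trans h1, h2.trans_eq h0.symm⟩
  exact ⟨y, (heq y).symm.trans hy⟩

lemma min_add_min_le_of_le {u v₁ v₂ w t : ℝ} (h1 : u ≤ v₁) (h2 : u ≤ v₂)
    (h : w + u = v₁ + v₂) : min w t + min u t ≤ min v₁ t + min v₂ t := by
  rcases le_total w t with a | a <;> rcases le_total u t with b | b <;>
  rcases le_total v₁ t with c | c <;> rcases le_total v₂ t with d | d <;>
  simp only [min_eq_left, min_eq_right, *] <;> linarith

lemma integral_min_indConv_submodular {B C C' : Set G} (hB : MeasurableSet B)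
    (hC : MeasurableSet C) (hC' : MeasurableSet C') (t : ℝ) :
    ∫ x, min (indConv μ B (C ∪ C') x) t ∂μ + ∫ x, min (indConv μ B (C ∩ C') x) t ∂μ ≤
      ∫ x, min (indConv μ B C x) t ∂μ + ∫ x, min (indConv μ B C' x) t ∂μ := by
  rw [← integral_add (integrable_min_indConv hB (hC.union hC') t)
      (integrable_min_indConv hB (hC.inter hC') t),
    ← integral_add (integrable_min_indConv hB hC t) (integrable_min_indConv hB hC' t)]
  refine integral_mono ((integrable_min_indConv hB (hC.union hC') t).add
      (integrable_min_indConv hB (hC.inter hC') t))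
    ((integrable_min_indConv hB hC t).add (integrable_min_indConv hB hC' t)) fun x => ?_
  exact min_add_min_le_of_le (indConv_mono B Set.inter_subset_left x)
    (indConv_mono B Set.inter_subset_right x) (indConv_union_add_inter B hB hC' x)

lemma integral_min_indConv_translate (B C : Set G) (t : ℝ) (z : G) :
    ∫ x, min (indConv μ B ((fun x => x - z) ⁻¹' C) x) t ∂μ = ∫ x, min (indConv μ B C x) t ∂μ := by
  rw [← integral_sub_right_eq_self (fun x => min (indConv μ B C x) t) z]
  congr 1
  ext x
  simp only [indConv, Set.mem_preimage]
  congr 4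
  ext y
  rw [sub_right_comm]

lemma integral_min_indConv_of_le {B C : Set G} (hB : MeasurableSet B) (hC : MeasurableSet C)
    {t : ℝ} (h : μ.real B ≤ t ∨ μ.real C ≤ t) :
    ∫ x, min (indConv μ B C x) t ∂μ = μ.real B * μ.real C := by
  rw [← integral_indConv hB hC]
  congr 1
  ext x
  refine min_eq_left ?_
  rcases h with h | h
  · exact (indConv_le_left B C x).trans h
  · exact (indConv_le_right B hC x).trans h

lemma integral_min_indConv_of_ge {B C : Set G} (hC : MeasurableSet C)
    {t : ℝ} (h : t ≤ μ.real B + μ.real C - 1) :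
    ∫ x, min (indConv μ B C x) t ∂μ = t := by
  have : ∀ x, min (indConv μ B C x) t = t := fun x =>
    min_eq_right (h.trans (add_sub_one_le_indConv hC x))
  simp [this]

lemma mul_le_integral_min_indConv [PreconnectedSpace G] [μ.InnerRegularCompactLTTop]
    {B C : Set G} (hB : MeasurableSet B) (hC : MeasurableSet C) {t : ℝ} (ht : 0 < t)
    (htB : t < μ.real B) (htC : t ≤ μ.real C) (hBC : μ.real B + μ.real C ≤ 1 + t) :
    t * (μ.real B + μ.real C - t) ≤ ∫ x, min (indConv μ B C x) t ∂μ := by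
  by_contra! hlt
  set b := μ.real B with hb
  have hb1 : b ≤ 1 := measureReal_le_one
  set F : Set G → ℝ := fun D => ∫ x, min (indConv μ B D x) t ∂μ with hF
  obtain ⟨η, hη, hηC⟩ : ∃ η > 0, F C - t * (b + μ.real C - t) = -η :=
    ⟨-(F C - t * (b + μ.real C - t)), by simp only [hF]; linarith, by ring⟩
  set δ := min (t * (b - t)) (η / 4) with hδ
  have hδ0 : 0 < δ := lt_min (mul_pos ht (by linarith)) (by linarith)
  have hδη : δ ≤ η / 4 := min_le_right _ _
  have hδt : δ ≤ t * (b - t) := min_le_left _ _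
  have hδ1 : δ ≤ 1 := hδt.trans (by nlinarith)
  set ε := η / 4 with hε
  -- A small quadratic perturbation makes the functional strictly concave.
  set Φ : Set G → ℝ := fun D => F D - t * (b + μ.real D - t) - ε * μ.real D ^ 2 with hΦ
  set S : Set (Set G) := {D | MeasurableSet D ∧ t - δ ≤ μ.real D ∧ b + μ.real D ≤ 1 + t + δ} with hS
  have hCS : C ∈ S := ⟨hC, by linarith, by linarith⟩
  have hFnn : ∀ D, 0 ≤ F D := fun D => integral_nonneg fun x => le_min (indConv_nonneg _ _ _) ht.le
  have hbdd : BddBelow (Φ '' S) := by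
    refine ⟨-(t * 2) - ε, ?_⟩
    rintro _ ⟨D, -, rfl⟩
    have h1 : μ.real D ≤ 1 := measureReal_le_one
    have h0 : 0 ≤ μ.real D := measureReal_nonneg
    have h2 : t * (b + μ.real D - t) ≤ t * 2 := by gcongr; linarith
    have h3 : ε * μ.real D ^ 2 ≤ ε * 1 := by gcongr; nlinarith
    have := hFnn D
    simp only [hΦ]; linarith
  have hne : (Φ '' S).Nonempty := ⟨_, C, hCS, rfl⟩
  have hεδ : 0 < ε * δ ^ 2 := by positivity
  obtain ⟨_, ⟨D, ⟨hD, hD1, hD2⟩, rfl⟩, hDm⟩ := Real.lt_sInf_add_pos hne hεδ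
  have hmC : sInf (Φ '' S) ≤ -η := by
    refine (csInf_le hbdd ⟨C, hCS, rfl⟩).trans ?_
    have : 0 ≤ ε * μ.real C ^ 2 := by positivity
    simp only [hΦ]; linarith
  have hd1 : μ.real D ≤ 1 := measureReal_le_one
  have hd0 : 0 ≤ μ.real D := measureReal_nonneg
  have hεD : ε * μ.real D ^ 2 ≤ ε * 1 := by gcongr; nlinarith
  have hεδ' : ε * δ ^ 2 ≤ ε * 1 := by gcongr; nlinarith
  rcases lt_or_ge (μ.real D) t with h | h
  · have : F D = b * μ.real D := integral_min_indConv_of_le hB hD (.inr h.le)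
    have h5 : (t - μ.real D) * (b - t) ≤ δ * 1 := by gcongr <;> linarith
    simp only [hΦ, this] at hDm
    nlinarith
  rcases lt_or_ge (1 + t) (b + μ.real D) with h' | h'
  · have : F D = t := integral_min_indConv_of_ge hD (by linarith)
    have h5 : t * (b + μ.real D - t - 1) ≤ 1 * δ := by
      gcongr <;> linarith
    simp only [hΦ, this] at hDm
    linarith
  have hδD : δ ≤ μ.real D * (1 - μ.real D) := by
    exact hδt.trans (mul_le_mul h (by linarith) (by linarith) hd0)
  obtain ⟨y, hy⟩ := exists_measureReal_inter_translate (μ := μ) hD (r := μ.real D - δ)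
    (by linarith) (by linarith)
  set D' := (fun x => x - y) ⁻¹' D with hD'
  have hD'm : MeasurableSet D' := (measurable_id.sub_const y) hD
  have hD'r : μ.real D' = μ.real D :=
    (measurePreserving_sub_right μ y).measureReal_preimage hD.nullMeasurableSet
  have hU := measureReal_union_add_inter (μ := μ) (s := D) hD'm
  have hUr : μ.real (D ∪ D') = μ.real D + δ := by linarith
  have hsub := integral_min_indConv_submodular (μ := μ) hB hD hD'm t
  have htr : F D' = F D := integral_min_indConv_translate B D t y
  have m1 : sInf (Φ '' S) ≤ Φ (D ∪ D') :=
    csInf_le hbdd ⟨_, ⟨hD.union hD'm, by linarith, by linarith⟩, rfl⟩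
  have m2 : sInf (Φ '' S) ≤ Φ (D ∩ D') :=
    csInf_le hbdd ⟨_, ⟨hD.inter hD'm, by linarith, by linarith⟩, rfl⟩
  have hsum : Φ (D ∪ D') + Φ (D ∩ D') ≤ 2 * Φ D - 2 * (ε * δ ^ 2) := by
    simp only [hΦ, hUr, hy]
    change F (D ∪ D') + F (D ∩ D') ≤ F D + F D' at hsub
    nlinarith
  linarith

/-- A Pollard-type inequality in a compact connected group. -/
theorem mul_min_le_integral_min_indConv [PreconnectedSpace G] [μ.InnerRegularCompactLTTop]
    {B C : Set G} (hB : MeasurableSet B) (hC : MeasurableSet C) {t : ℝ} (ht : 0 ≤ t)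
    (htB : t ≤ μ.real B) (htC : t ≤ μ.real C) :
    t * min 1 (μ.real B + μ.real C - t) ≤ ∫ x, min (indConv μ B C x) t ∂μ := by
  have h1 : t * min 1 (μ.real B + μ.real C - t) ≤ t * (μ.real B + μ.real C - t) := by
    gcongr; exact min_le_right _ _
  rcases ht.eq_or_lt with rfl | ht
  · rw [zero_mul]
    exact integral_nonneg fun x => le_min (indConv_nonneg _ _ _) le_rfl
  rcases htB.eq_or_lt with h | htB
  · refine h1.trans_eq ?_
    rw [integral_min_indConv_of_le hB hC (.inl h.ge), ← h]
    ring
  rcases le_total (μ.real B + μ.real C) (1 + t) with h | h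
  · exact h1.trans (mul_le_integral_min_indConv hB hC ht htB htC h)
  · rw [integral_min_indConv_of_ge hC (by linarith)]
    exact mul_le_of_le_one_right ht.le (min_le_left _ _)

end CompactGroup

section Levels

variable {α β : Type*} [MeasurableSpace α] [MeasurableSpace β]

lemma lintegral_measure_section_comm (μ : Measure α) (ν : Measure β) [SFinite μ] [SFinite ν]
    {S : Set (α × β)} (hS : MeasurableSet S) :
    ∫⁻ y, μ {x | (x, y) ∈ S} ∂ν = ∫⁻ x, ν {y | (x, y) ∈ S} ∂μ :=
  (Measure.prod_apply_symm hS).symm.trans (Measure.prod_apply hS)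

lemma measurableSet_Ioo_section (t : ℝ) {h : α → ℝ} (hh : Measurable h) :
    MeasurableSet {p : α × ℝ | p.2 ∈ Set.Ioo t (h p.1)} :=
  (measurableSet_lt measurable_const measurable_snd).inter
    (measurableSet_lt measurable_snd (hh.comp measurable_fst))

lemma lintegral_measure_Ioo_section (μ : Measure α) [SFinite μ] (t : ℝ) {h : α → ℝ}
    (hh : Measurable h) :
    ∫⁻ s, μ {x | s ∈ Set.Ioo t (h x)} = ∫⁻ x, ENNReal.ofReal (h x - t) ∂μ := by
  refine (lintegral_measure_section_comm μ volume (measurableSet_Ioo_section t hh)).trans ?_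
  refine lintegral_congr fun x => ?_
  exact Real.volume_Ioo (a := t) (b := h x)

/-- Layer-cake formula for a product of functions. -/
lemma lintegral_prod_ofReal (μ : Measure α) [SFinite μ] {n : ℕ} {h : Fin n → α → ℝ}
    (hh : ∀ i, Measurable (h i)) :
    ∫⁻ x, ∏ i, ENNReal.ofReal (h i x) ∂μ =
      ∫⁻ s : Fin n → ℝ, μ {x | ∀ i, s i ∈ Set.Ioo 0 (h i x)} := by
  have hm : MeasurableSet {p : α × (Fin n → ℝ) | ∀ i, p.2 i ∈ Set.Ioo 0 (h i p.1)} := by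
    rw [Set.ofPred_forall]
    exact .iInter fun i => (measurableSet_Ioo_section 0 (hh i)).preimage
      (f := fun p : α × (Fin n → ℝ) => (p.1, p.2 i)) (by fun_prop)
  refine Eq.trans (lintegral_congr fun x => ?_)
    (lintegral_measure_section_comm μ volume hm).symm
  have := Real.volume_pi_Ioo (a := fun _ => 0) (b := fun i => h i x)
  simp only [sub_zero] at this
  rw [← this]
  congr 1
  ext s
  simp

/-- If each `f i` is dominated by `g i` after every truncation, then so are the integrals of the
coordinatewise infima. -/
lemma lintegral_inf_iInf_le {n : ℕ} {f g : Fin n → ℝ → ENNReal} (hf : ∀ i, Measurable (f i))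
    (hg : ∀ i, Measurable (g i))
    (H : ∀ i r, ∫⁻ s, r ⊓ f i s ≤ ∫⁻ s, r ⊓ g i s) (r : ENNReal) :
    ∫⁻ s : Fin n → ℝ, r ⊓ ⨅ i, f i (s i) ≤ ∫⁻ s : Fin n → ℝ, r ⊓ ⨅ i, g i (s i) := by
  induction n generalizing r with
  | zero => simp
  | succ n ih =>
    have split : ∀ {k : Fin (n + 1) → ℝ → ENNReal}, ∫⁻ s : Fin (n + 1) → ℝ, r ⊓ ⨅ i, k i (s i) =
        ∫⁻ p : ℝ × (Fin n → ℝ), r ⊓ k 0 p.1 ⊓ ⨅ i, k (Fin.succ i) (p.2 i) := by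
      intro k
      rw [← (volume_preserving_piFinSuccAbove (fun _ => ℝ) 0).lintegral_comp_emb
        (MeasurableEquiv.measurableEmbedding _)]
      refine lintegral_congr fun s => ?_
      rw [inf_assoc]
      congr 1
      refine le_antisymm (le_inf (iInf_le _ 0) (le_iInf fun i => iInf_le _ i.succ)) ?_
      refine le_iInf fun i => ?_
      refine Fin.cases inf_le_left (fun i => inf_le_right.trans (iInf_le _ i)) i
    have hmeas : ∀ {k₀ : ℝ → ENNReal} {k : Fin n → ℝ → ENNReal}, Measurable k₀ →
        (∀ i, Measurable (k i)) →
        Measurable fun p : ℝ × (Fin n → ℝ) => r ⊓ k₀ p.1 ⊓ ⨅ i, k i (p.2 i) := by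
      intro k₀ k h₀ h
      exact (measurable_const.inf (h₀.comp measurable_fst)).inf
        (.iInf fun i => (h i).comp ((measurable_pi_apply i).comp measurable_snd))
    rw [split, split]
    calc _ ≤ ∫⁻ p : ℝ × (Fin n → ℝ), r ⊓ f 0 p.1 ⊓ ⨅ i, g (Fin.succ i) (p.2 i) := by
          rw [Measure.volume_eq_prod,
            lintegral_prod _ (hmeas (hf 0) fun i => hf i.succ).aemeasurable,
            lintegral_prod _ (hmeas (hf 0) fun i => hg i.succ).aemeasurable]
          exact lintegral_mono fun s => ih (fun i => hf i.succ) (fun i => hg i.succ)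
            (fun i => H i.succ) (r ⊓ f 0 s)
      _ ≤ _ := by
          rw [Measure.volume_eq_prod,
            lintegral_prod_symm _ (hmeas (hf 0) fun i => hg i.succ).aemeasurable,
            lintegral_prod_symm _ (hmeas (hg 0) fun i => hg i.succ).aemeasurable]
          refine lintegral_mono fun s => ?_
          have := H 0 (r ⊓ ⨅ i, g (Fin.succ i) (s i))
          simp_rw [inf_right_comm r] at this
          exact this

end Levels

/-- A lower bound for the distribution function, at positive levels, of the convolution of the
indicators of arcs of lengths `b` and `c` in the circle. -/
noncomputable def trap (b c s : ℝ) : ℝ :=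
  if s ≤ 0 then 0 else if s < b + c - 1 then 1 else if s < min b c then b + c - 2 * s else 0

lemma measurable_trap (b c : ℝ) : Measurable (trap b c) := by
  unfold trap
  refine Measurable.ite measurableSet_Iic measurable_const ?_
  refine Measurable.ite measurableSet_Iio measurable_const ?_
  exact Measurable.ite measurableSet_Iio (by fun_prop) measurable_const

lemma integral_sub_two_mul (k t M : ℝ) :
    ∫ s in t..M, (k - 2 * s) = k * (M - t) - (M ^ 2 - t ^ 2) := by
  rw [intervalIntegral.integral_sub (by simp) (by apply Continuous.intervalIntegrable; fun_prop),
    intervalIntegral.integral_const_mul, integral_id]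
  simp
  ring

lemma exists_le_lintegral_min_trap {b c r : ℝ} (hb : 0 ≤ b) (hc : 0 ≤ c) (hb1 : b ≤ 1)
    (hc1 : c ≤ 1) (hr1 : r ≤ 1) :
    ∃ t, 0 ≤ t ∧ t ≤ b ∧ t ≤ c ∧
      ENNReal.ofReal r * ENNReal.ofReal t + ENNReal.ofReal (b * c - t * min 1 (b + c - t)) ≤
        ∫⁻ s, ENNReal.ofReal r ⊓ ENNReal.ofReal (trap b c s) := by
  set M := min b c with hM
  set m := max 0 (b + c - 1) with hm
  set t := max m (min M ((b + c - r) / 2)) with ht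
  have hmM : m ≤ M := max_le (le_min hb hc) (le_min (by linarith) (by linarith))
  have htM : t ≤ M := max_le hmM (min_le_left _ _)
  have hm0 : 0 ≤ m := le_max_left _ _
  have ht0 : 0 ≤ t := hm0.trans (le_max_left _ _)
  have hMprod : M * (b + c) - M ^ 2 = b * c := by
    rcases le_total b c with h | h <;> simp only [hM, min_eq_left, min_eq_right, h] <;> ring
  have hMb : M ≤ b := min_le_left _ _
  have hMc : M ≤ c := min_le_right _ _
  refine ⟨t, ht0, htM.trans hMb, htM.trans hMc, ?_⟩
  have hval : b * c - t * min 1 (b + c - t) = ∫ s in t..M, (b + c - 2 * s) := by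
    have hmt : b + c - t ≤ 1 := by
      have : b + c - 1 ≤ t := (le_max_right _ _).trans (le_max_left _ _)
      linarith
    rw [integral_sub_two_mul, min_eq_right hmt]
    linarith
  have hnn : ∀ s ∈ Set.Ioc t M, 0 ≤ b + c - 2 * s := fun s hs => by linarith [hs.2]
  rw [hval, intervalIntegral.integral_of_le htM, ofReal_integral_eq_lintegral_ofReal
    (((by fun_prop : Continuous fun s : ℝ => b + c - 2 * s).integrableOn_Icc).mono_set
      Set.Ioc_subset_Icc_self)
    ((ae_restrict_iff' measurableSet_Ioc).2 (.of_forall hnn))]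
  have h1 : ENNReal.ofReal r * ENNReal.ofReal t = ∫⁻ _ in Set.Ioo 0 t, ENNReal.ofReal r := by
    simp
  rw [h1, ← restrict_Ioo_eq_restrict_Ioc]
  refine (add_le_add (setLIntegral_mono' measurableSet_Ioo fun s hs => ?_)
    (setLIntegral_mono' measurableSet_Ioo fun s hs => ?_)).trans
    ((lintegral_union measurableSet_Ioo ?_).symm.trans_le (setLIntegral_le_lintegral _ _))
  · refine le_inf le_rfl (ENNReal.ofReal_le_ofReal ?_)
    rw [trap, if_neg hs.1.not_ge]
    split_ifs with h₁ h₂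
    · exact hr1
    · have hms : m ≤ s := max_le hs.1.le (not_lt.1 h₁)
      rcases lt_max_iff.1 hs.2 with h | h
      · exact absurd hms h.not_ge
      · linarith [(lt_min_iff.1 h).2]
    · exact absurd (hs.2.trans_le htM) h₂
  · have hms : m < s := (le_max_left _ _).trans_lt hs.1
    obtain ⟨hs0, hs1⟩ := max_lt_iff.1 hms
    rw [trap, if_neg hs0.not_ge, if_neg hs1.le.not_gt, if_pos hs.2]
    refine le_inf (ENNReal.ofReal_le_ofReal ?_) le_rfl
    have h := (le_max_right _ _).trans_lt hs.1
    rcases min_lt_iff.1 h with h | h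
    · exact absurd hs.2 h.not_gt
    · linarith
  · exact Set.disjoint_left.2 fun s h h' => h.2.not_gt h'.1

section CompactGroup

variable {G : Type*} [AddCommGroup G] [TopologicalSpace G] [IsTopologicalAddGroup G]
  [PreconnectedSpace G] [MeasurableSpace G] [BorelSpace G] [SecondCountableTopology G]
  {μ : Measure G} [IsProbabilityMeasure μ] [μ.IsAddLeftInvariant] [μ.IsNegInvariant]
  [μ.InnerRegularCompactLTTop]

lemma lintegral_inf_level_le {B C : Set G} (hB : MeasurableSet B) (hC : MeasurableSet C) {t : ℝ}
    (ht : 0 ≤ t) (htB : t ≤ μ.real B) (htC : t ≤ μ.real C) (r : ENNReal) :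
    ∫⁻ s, r ⊓ μ {x | s ∈ Set.Ioo 0 (indConv μ B C x)} ≤ r * ENNReal.ofReal t +
      ENNReal.ofReal (μ.real B * μ.real C - t * min 1 (μ.real B + μ.real C - t)) := by
  have hm := measurable_indConv (μ := μ) hB hC
  calc _ ≤ ∫⁻ s, ((Set.Ioc 0 t).indicator (fun _ => r) s +
        μ {x | s ∈ Set.Ioo t (indConv μ B C x)}) := by
        refine lintegral_mono fun s => ?_
        rcases le_or_gt s t with hst | hst
        · rcases le_or_gt s 0 with hs | hs
          · simp [hs.not_gt]
          · rw [Set.indicator_of_mem (show s ∈ Set.Ioc 0 t from ⟨hs, hst⟩)]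
            exact inf_le_left.trans le_self_add
        · refine inf_le_right.trans (le_trans (measure_mono ?_) le_add_self)
          exact fun x hx => ⟨hst, hx.2⟩
    _ = r * ENNReal.ofReal t + ENNReal.ofReal (∫ x, indConv μ B C x ∂μ -
          ∫ x, min (indConv μ B C x) t ∂μ) := by
        rw [lintegral_add_left (measurable_const.indicator measurableSet_Ioc),
          lintegral_indicator measurableSet_Ioc, setLIntegral_const, Real.volume_Ioc, sub_zero,
          lintegral_measure_Ioo_section μ t hm,
          ← integral_sub (integrable_indConv hB hC) (integrable_min_indConv hB hC t),
          ofReal_integral_eq_lintegral_ofReal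
            (f := fun x => indConv μ B C x - min (indConv μ B C x) t)
            ((integrable_indConv hB hC).sub (integrable_min_indConv hB hC t))
            (.of_forall fun x => sub_nonneg.2 (min_le_left _ _))]
        congr 1
        refine lintegral_congr fun x => ?_
        rcases le_total (indConv μ B C x) t with h | h
        · rw [min_eq_left h, sub_self, ENNReal.ofReal_zero, ENNReal.ofReal_eq_zero]
          linarith
        · rw [min_eq_right h]
    _ ≤ _ := by
        rw [integral_indConv hB hC]
        gcongr
        exact mul_min_le_integral_min_indConv hB hC ht htB htC

lemma lintegral_inf_level_le_trap {B C : Set G} (hB : MeasurableSet B) (hC : MeasurableSet C)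
    (r : ENNReal) :
    ∫⁻ s, r ⊓ μ {x | s ∈ Set.Ioo 0 (indConv μ B C x)} ≤
      ∫⁻ s, r ⊓ ENNReal.ofReal (trap (μ.real B) (μ.real C) s) := by
  set q := (r ⊓ 1).toReal with hq
  have hqr : ENNReal.ofReal q = r ⊓ 1 :=
    ENNReal.ofReal_toReal (ne_top_of_le_ne_top ENNReal.one_ne_top inf_le_right)
  have hq1 : q ≤ 1 := ENNReal.toReal_le_of_le_ofReal zero_le_one (by simp)
  obtain ⟨t, ht, htB, htC, h⟩ := exists_le_lintegral_min_trap (b := μ.real B) (c := μ.real C)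
    measureReal_nonneg measureReal_nonneg measureReal_le_one measureReal_le_one hq1
  calc _ ≤ ∫⁻ s, ENNReal.ofReal q ⊓ μ {x | s ∈ Set.Ioo 0 (indConv μ B C x)} := by
        refine lintegral_mono fun s => ?_
        rw [hqr]
        exact le_inf (le_inf inf_le_left (inf_le_right.trans prob_le_one)) inf_le_right
    _ ≤ _ := lintegral_inf_level_le hB hC ht htB htC _
    _ ≤ _ := h
    _ ≤ _ := by
        refine lintegral_mono fun s => ?_
        rw [hqr]
        exact inf_le_inf_right _ inf_le_left

/-- A rearrangement inequality for products of convolutions of indicator functions. -/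
theorem lintegral_prod_indConv_le {n : ℕ} {B C : Fin n → Set G} (hB : ∀ i, MeasurableSet (B i))
    (hC : ∀ i, MeasurableSet (C i)) :
    ∫⁻ x, ∏ i, ENNReal.ofReal (indConv μ (B i) (C i) x) ∂μ ≤
      ∫⁻ s : Fin n → ℝ, 1 ⊓ ⨅ i, ENNReal.ofReal (trap (μ.real (B i)) (μ.real (C i)) (s i)) := by
  have hm := fun i => measurable_indConv (μ := μ) (hB i) (hC i)
  rw [lintegral_prod_ofReal μ hm]
  refine le_trans (lintegral_mono fun s => ?_) (lintegral_inf_iInf_le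
    (f := fun i s => μ {x | s ∈ Set.Ioo 0 (indConv μ (B i) (C i) x)}) (fun i => ?_)
    (fun i => (measurable_trap _ _).ennreal_ofReal)
    (fun i r => lintegral_inf_level_le_trap (hB i) (hC i) r) 1)
  · exact le_inf prob_le_one (le_iInf fun i => measure_mono fun x hx => hx i)
  · exact measurable_measure_prodMk_right (measurableSet_Ioo_section 0 (hm i))

end CompactGroup

section Torus

instance : IsProbabilityMeasure (volume : Measure 𝕋) := ⟨by simp [AddCircle.measure_univ]⟩

instance : (volume : Measure 𝕋).IsNegInvariant :=
  Measure.IsAddHaarMeasure.isNegInvariant_of_regular _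

lemma norm_coe_circle {r : ℝ} (h : |r| ≤ 1 / 2) : ‖(r : 𝕋)‖ = |r| :=
  (AddCircle.norm_coe_eq_abs_iff 1 one_ne_zero).2 (by simpa using h)

lemma exists_coe_circle (v : 𝕋) : ∃ r : ℝ, (r : 𝕋) = v ∧ |r| ≤ 1 / 2 := by
  induction v using QuotientAddGroup.induction_on with
  | H z =>
    refine ⟨z - round z, ?_, abs_sub_round z⟩
    have h : ((round z : ℝ) : 𝕋) = 0 := (AddCircle.coe_eq_zero_iff 1).2 ⟨round z, by simp⟩
    rw [AddCircle.coe_sub, h, sub_zero]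

lemma lt_norm_coe_circle {α θ : ℝ} (h1 : α < θ) (h2 : θ < 1 - α) : α < ‖(θ : 𝕋)‖ := by
  rw [AddCircle.norm_eq, inv_one, one_mul, mul_one, lt_abs]
  rcases le_or_gt (round θ) 0 with h | h
  · have : (round θ : ℝ) ≤ 0 := by exact_mod_cast h
    left; linarith
  · have : (1 : ℝ) ≤ round θ := by exact_mod_cast h
    right; linarith

lemma sub_le_volume_of_forall_mem {S : Set 𝕋} (hS : MeasurableSet S) {p q : ℝ} (hp : -(1 / 2) ≤ p)
    (hq : q ≤ 1 / 2) (h : ∀ η ∈ Set.Ioo p q, (η : 𝕋) ∈ S) : q - p ≤ volume.real S := by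
  have h1 := (AddCircle.measurePreserving_mk 1 (-(1 / 2))).measureReal_preimage
    hS.nullMeasurableSet
  rw [← h1]
  have h2 : (volume.restrict (Set.Ioc (-(1 / 2) : ℝ) (-(1 / 2) + 1))).real (Set.Ioo p q) =
      volume.real (Set.Ioo p q) := by
    rw [measureReal_restrict_apply measurableSet_Ioo, Set.inter_eq_left.2]
    exact fun x hx => ⟨hp.trans_lt hx.1, by linarith [hx.2]⟩
  calc q - p ≤ volume.real (Set.Ioo p q) := by
        rw [Real.volume_real_Ioo]; exact le_max_left _ _
    _ ≤ _ := h2.symm.trans_le (measureReal_mono h)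

lemma measurableSet_norm_le (c : ℝ) : MeasurableSet {y : 𝕋 | ‖y‖ ≤ c} :=
  measurableSet_le (by fun_prop) (by fun_prop)

lemma measurableSet_arc_diff (α β : ℝ) (v : 𝕋) :
    MeasurableSet {y : 𝕋 | ‖y‖ ≤ β ∧ α < ‖v - y‖} := by
  have h : MeasurableSet {y : 𝕋 | α < ‖v - y‖} := measurableSet_lt (by fun_prop) (by fun_prop)
  exact (measurableSet_norm_le β).inter h

lemma min_le_volume_arc_diff {α β : ℝ} (hβ : β ≤ 1 / 2) (v : 𝕋) :
    min (min (2 * β) (1 - 2 * α)) (β - α + ‖v‖) ≤ volume.real {y : 𝕋 | ‖y‖ ≤ β ∧ α < ‖v - y‖} := by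
  have hS : MeasurableSet {y : 𝕋 | ‖y‖ ≤ β ∧ α < ‖v - y‖} :=
    measurableSet_arc_diff α β v
  obtain ⟨r, rfl, hr⟩ := exists_coe_circle v
  rw [norm_coe_circle hr]
  have hr' := abs_le.1 hr
  have hnorm : ∀ η : ℝ, -β < η → η < β → ‖(η : 𝕋)‖ ≤ β := fun η h1 h2 => by
    rw [norm_coe_circle (abs_le.2 ⟨by linarith, by linarith⟩)]
    exact (abs_lt.2 ⟨h1, h2⟩).le
  rcases le_total 0 r with h | h
  · rw [abs_of_nonneg h]
    refine le_trans ?_ (sub_le_volume_of_forall_mem (p := max (-β) (r - 1 + α))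
      (q := min β (r - α)) hS (le_max_of_le_left (by linarith)) (min_le_of_left_le hβ) ?_)
    · rcases max_cases (-β) (r - 1 + α) with h1 | h1 <;>
      rcases min_cases β (r - α) with h2 | h2 <;> rw [h1.1, h2.1]
      · exact min_le_of_left_le (min_le_of_left_le (by linarith))
      · exact min_le_of_right_le (by linarith)
      · exact min_le_of_right_le (by linarith)
      · exact min_le_of_left_le (min_le_of_right_le (by linarith))
    · intro η hη
      obtain ⟨h1, h2⟩ := max_lt_iff.1 hη.1
      obtain ⟨h3, h4⟩ := lt_min_iff.1 hη.2
      refine ⟨hnorm η h1 h3, ?_⟩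
      rw [← AddCircle.coe_sub]
      exact lt_norm_coe_circle (by linarith) (by linarith)
  · rw [abs_of_nonpos h]
    refine le_trans ?_ (sub_le_volume_of_forall_mem (p := max (-β) (r + α))
      (q := min β (r + 1 - α)) hS (le_max_of_le_left (by linarith)) (min_le_of_left_le hβ) ?_)
    · rcases max_cases (-β) (r + α) with h1 | h1 <;>
      rcases min_cases β (r + 1 - α) with h2 | h2 <;> rw [h1.1, h2.1]
      · exact min_le_of_left_le (min_le_of_left_le (by linarith))
      · exact min_le_of_right_le (by linarith)
      · exact min_le_of_right_le (by linarith)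
      · exact min_le_of_left_le (min_le_of_right_le (by linarith))
    · intro η hη
      obtain ⟨h1, h2⟩ := max_lt_iff.1 hη.1
      obtain ⟨h3, h4⟩ := lt_min_iff.1 hη.2
      refine ⟨hnorm η h1 h3, ?_⟩
      rw [← AddCircle.coe_sub, ← norm_neg, ← AddCircle.coe_neg]
      exact lt_norm_coe_circle (by linarith) (by linarith)

variable {d : ℕ}

lemma band_eq {c : ℝ} (hc : c ≤ 1 / 2) :
    band d c = Function.eval 0 ⁻¹' {y : 𝕋 | ‖y‖ ≤ c} := by
  ext x
  simp only [band, Set.mem_preimage, Function.eval]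
  constructor
  · rintro ⟨r, hr, h⟩
    have h1 : |r| ≤ c := abs_le.2 hr
    change ‖x 0‖ ≤ c
    rw [← h, norm_coe_circle (h1.trans hc)]
    exact h1
  · intro h
    obtain ⟨r, hr, hr2⟩ := exists_coe_circle (x 0)
    refine ⟨r, abs_le.1 ?_, hr⟩
    rw [← norm_coe_circle hr2, hr]
    exact h

lemma measureReal_preimage_eval_zero {S : Set 𝕋} (hS : MeasurableSet S) :
    volume.real (Function.eval 0 ⁻¹' S : Set (Fin (d + 1) → 𝕋)) = volume.real S :=
  (measurePreserving_eval (fun _ : Fin (d + 1) => (volume : Measure 𝕋)) 0).measureReal_preimage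
    hS.nullMeasurableSet

lemma volume_real_norm_le {c : ℝ} (hc0 : 0 ≤ c) (hc : c ≤ 1 / 2) :
    volume.real {y : 𝕋 | ‖y‖ ≤ c} = 2 * c := by
  have : {y : 𝕋 | ‖y‖ ≤ c} = Metric.closedBall 0 c := by ext; simp
  rw [this, Measure.real, AddCircle.volume_closedBall, min_eq_right (by linarith),
    ENNReal.toReal_ofReal (by linarith)]

lemma measurableSet_band {c : ℝ} (hc : c ≤ 1 / 2) : MeasurableSet (band d c) := by
  rw [band_eq hc]
  exact measurable_pi_apply 0 (measurableSet_norm_le c)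

lemma volume_real_band {c : ℝ} (hc0 : 0 ≤ c) (hc : c ≤ 1 / 2) :
    volume.real (band d c) = 2 * c := by
  rw [band_eq hc, measureReal_preimage_eval_zero (measurableSet_norm_le c),
    volume_real_norm_le hc0 hc]

lemma min_le_indConv_band {α β : ℝ} (hα : α ≤ 1 / 2) (hβ : β ≤ 1 / 2)
    (x : Fin (d + 1) → 𝕋) :
    min (min (2 * β) (1 - 2 * α)) (β - α + ‖x 0‖) ≤
      indConv volume (band d β) (band d α)ᶜ x := by
  refine (min_le_volume_arc_diff hβ (x 0)).trans_eq ?_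
  rw [← measureReal_preimage_eval_zero (d := d) (measurableSet_arc_diff α β (x 0)), indConv,
    band_eq hα, band_eq hβ]
  congr 1
  ext y
  simp

/-- Bands are extremal for the rearrangement inequality. -/
lemma le_lintegral_prod_indConv_band {n : ℕ} {a b : Fin n → ℝ}
    (ha : ∀ i, 0 ≤ a i ∧ a i ≤ 1 / 2) (hb : ∀ i, 0 ≤ b i ∧ b i ≤ 1 / 2) :
    ∫⁻ s : Fin n → ℝ, 1 ⊓ ⨅ i, ENNReal.ofReal (trap (2 * b i) (1 - 2 * a i) (s i)) ≤
      ∫⁻ x : Fin (d + 1) → 𝕋,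
        ∏ i, ENNReal.ofReal (indConv volume (band d (b i)) (band d (a i))ᶜ x) := by
  have hBm : ∀ i, MeasurableSet (band d (b i)) := fun i => measurableSet_band (hb i).2
  have hAm : ∀ i, MeasurableSet (band d (a i)) := fun i => measurableSet_band (ha i).2
  rw [lintegral_prod_ofReal volume fun i => measurable_indConv (hBm i) (hAm i).compl]
  refine lintegral_mono fun s => ?_
  set q := 1 ⊓ ⨅ i, ENNReal.ofReal (trap (2 * b i) (1 - 2 * a i) (s i)) with hq
  have hqtop : q ≠ ⊤ := ne_top_of_le_ne_top ENNReal.one_ne_top inf_le_left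
  rcases eq_zero_or_pos q with h0 | hpos
  · simp [h0]
  set ρ := q.toReal with hρ
  have hρ0 : 0 < ρ := ENNReal.toReal_pos hpos.ne' hqtop
  have hρ1 : ρ ≤ 1 := ENNReal.toReal_le_of_le_ofReal zero_le_one (by simp [hq])
  have hρt : ∀ i, ρ ≤ trap (2 * b i) (1 - 2 * a i) (s i) := by
    intro i
    have h1 : q ≤ ENNReal.ofReal (trap (2 * b i) (1 - 2 * a i) (s i)) :=
      inf_le_right.trans (iInf_le _ i)
    have h2 : 0 < trap (2 * b i) (1 - 2 * a i) (s i) :=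
      ENNReal.ofReal_pos.1 (hpos.trans_le h1)
    exact ENNReal.toReal_le_of_le_ofReal h2.le h1
  have hvol : volume ((band d (1 / 2 - ρ / 2))ᶜ) = q := by
    rw [← ENNReal.toReal_eq_toReal_iff' (measure_ne_top _ _) hqtop, ← Measure.real,
      probReal_compl_eq_one_sub (measurableSet_band (by linarith)),
      volume_real_band (by linarith) (by linarith)]
    linarith
  rw [← hvol]
  refine measure_mono fun x hx i => ?_
  rw [band_eq (by linarith)] at hx
  have hx' : 1 / 2 - ρ / 2 < ‖x 0‖ := not_le.1 hx
  have ht := hρt i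
  unfold trap at ht
  split_ifs at ht with h1 h2 h3
  · linarith
  · refine ⟨not_le.1 h1, lt_of_lt_of_le ?_ (add_sub_one_le_indConv (hAm i).compl x)⟩
    rw [probReal_compl_eq_one_sub (hAm i), volume_real_band (ha i).1 (ha i).2,
      volume_real_band (hb i).1 (hb i).2]
    exact h2
  · refine ⟨not_le.1 h1, lt_of_lt_of_le ?_ (min_le_indConv_band (ha i).2 (hb i).2 x)⟩
    exact lt_min h3 (by linarith)
  · linarith

lemma lintegral_union_add_lintegral_prod {n : ℕ} {A B : Fin n → Set (Fin d → 𝕋)}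
    (hA : ∀ i, MeasurableSet (A i)) :
    (∫⁻ b in Set.univ.pi B, volume (⋃ i, (· + b i) '' (A i))) +
      ∫⁻ x, ∏ i, ENNReal.ofReal (indConv volume (B i) (A i)ᶜ x) = ∏ i, volume (B i) := by
  have hm : MeasurableSet {p : (Fin d → 𝕋) × (Fin n → Fin d → 𝕋) | ∀ i, p.1 - p.2 i ∈ (A i)ᶜ} := by
    rw [Set.ofPred_forall]
    exact .iInter fun i => (hA i).compl.preimage
      (f := fun p : (Fin d → 𝕋) × (Fin n → Fin d → 𝕋) => p.1 - p.2 i) (by fun_prop)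
  have hJ : ∫⁻ x, ∏ i, ENNReal.ofReal (indConv volume (B i) (A i)ᶜ x) =
      ∫⁻ b in Set.univ.pi B, volume {x : Fin d → 𝕋 | ∀ i, x - b i ∈ (A i)ᶜ} := by
    refine Eq.trans (lintegral_congr fun x => ?_) (lintegral_measure_section_comm volume
      (volume.restrict (Set.univ.pi B)) hm).symm
    refine Eq.trans ?_ (Measure.restrict_apply (measurable_prodMk_left hm)).symm
    simp_rw [indConv, ofReal_measureReal (measure_ne_top _ _)]
    rw [← volume_pi_pi]
    congr 1
    ext b
    simp [forall_and, and_comm]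
  have hmeas : Measurable fun b : Fin n → Fin d → 𝕋 =>
      volume {x : Fin d → 𝕋 | ∀ i, x - b i ∈ (A i)ᶜ} := measurable_measure_prodMk_right hm
  rw [hJ, ← lintegral_add_right _ hmeas, ← volume_pi_pi,
    ← setLIntegral_one]
  refine lintegral_congr fun b => ?_
  have hmb : MeasurableSet {x : Fin d → 𝕋 | ∀ i, x - b i ∈ (A i)ᶜ} := measurable_prodMk_right hm
  have : ⋃ i, (· + b i) '' (A i) = {x : Fin d → 𝕋 | ∀ i, x - b i ∈ (A i)ᶜ}ᶜ := by
    ext x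
    simp [sub_eq_add_neg]
  rw [this, add_comm, prob_add_prob_compl hmb]

end Torus

theorem stmt11 (d n : ℕ) (hn : 1 ≤ n)
    (A B : Fin n → Set (Fin (d + 1) → 𝕋))
    (hAm : ∀ i, MeasurableSet (A i)) (hBm : ∀ i, MeasurableSet (B i))
    (hA0 : ∀ i, 0 < volume (A i)) (hB0 : ∀ i, 0 < volume (B i))
    (a b : Fin n → ℝ)
    (ha : ∀ i, 0 ≤ a i ∧ a i ≤ 1 / 2) (hb : ∀ i, 0 ≤ b i ∧ b i ≤ 1 / 2)
    (hvA : ∀ i, volume (band d (a i)) = volume (A i))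
    (hvB : ∀ i, volume (band d (b i)) = volume (B i)) :
    expUnionT A B ≥
      expUnionT (fun i => band d (a i)) (fun i => band d (b i)) := by
  have hU := lintegral_union_add_lintegral_prod (B := B) hAm
  have hU' := lintegral_union_add_lintegral_prod (B := fun i => band d (b i))
    fun i => measurableSet_band (d := d) (ha i).2
  have hrB : ∀ i, volume.real (B i) = 2 * b i := fun i => by
    rw [Measure.real, ← hvB, ← Measure.real, volume_real_band (hb i).1 (hb i).2]
  have hrA : ∀ i, volume.real (A i)ᶜ = 1 - 2 * a i := fun i => by
    rw [probReal_compl_eq_one_sub (hAm i), Measure.real, ← hvA, ← Measure.real,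
      volume_real_band (ha i).1 (ha i).2]
  have hle := (lintegral_prod_indConv_le (μ := volume) hBm fun i => (hAm i).compl)
  simp_rw [hrB, hrA] at hle
  replace hle := hle.trans (le_lintegral_prod_indConv_band (d := d) ha hb)
  simp_rw [hvB] at hU'
  have hPtop : ∏ i, volume (B i) ≠ ⊤ := ENNReal.prod_ne_top fun i _ => measure_ne_top _ _
  have hP0 : ∏ i, volume (B i) ≠ 0 := Finset.prod_ne_zero_iff.2 fun i _ => (hB0 i).ne'
  unfold expUnionT
  simp_rw [hvB]
  refine ENNReal.toReal_mono (ENNReal.mul_ne_top (ENNReal.inv_ne_top.2 hP0)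
    (ne_top_of_le_ne_top hPtop (le_self_add.trans_eq hU))) ?_
  gcongr _ * ?_
  refine (ENNReal.add_le_add_iff_right
    (ne_top_of_le_ne_top hPtop (le_add_self.trans_eq hU'))).1 ?_
  rw [hU', ← hU]
  gcongr
end

section
/- Let d, n ≥ 1 be integers and let A_1, …, A_n and B_1, …, B_n be measurable subsets of ℝ^d of finite positive Lebesgue measure. For each i, let A'_i and B'_i be closed Euclidean balls in ℝ^d centred at the origin with |A'_i| = |A_i| and |B'_i| = |B_i|. Then for b_i chosen independently and uniformly at random from B_i, and b'_i chosen independently and uniformly at random from B'_i, one has E(|⋃_{i=1}^n (A_i + b_i)|) ≥ E(|⋃_{i=1}^n (A'_i + b'_i)|). -/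
open MeasureTheory

/-- The expected volume of `⋃ i, (A i + b i)` when each `b i` is chosen independently
and uniformly at random from `B i`. -/
noncomputable def expUnion {d n : ℕ} (A B : Fin n → Set (EuclideanSpace ℝ (Fin d))) : ℝ :=
  ((∏ i, volume (B i))⁻¹ *
    ∫⁻ b in Set.univ.pi B, volume (⋃ i, (· + b i) '' (A i))).toReal

section

open Set
open scoped ENNReal

/-- The distribution function of the restriction of Lebesgue measure to `A`. -/
noncomputable def volCDF (A : Set ℝ) (x : ℝ) : ℝ := (volume (A ∩ Iic x)).toReal

lemma volume_inter_Iic_ne_top {A : Set ℝ} (hA : volume A ≠ ∞) (x : ℝ) :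
    volume (A ∩ Iic x) ≠ ∞ :=
  ne_top_of_le_ne_top hA (measure_mono inter_subset_left)

lemma volCDF_mono {A : Set ℝ} (hA : volume A ≠ ∞) : Monotone (volCDF A) := fun _ y hxy =>
  ENNReal.toReal_mono (volume_inter_Iic_ne_top hA y)
    (measure_mono (inter_subset_inter_right _ (Iic_subset_Iic.2 hxy)))

lemma volCDF_le_add {A : Set ℝ} (hA : volume A ≠ ∞) {x y : ℝ} (hxy : x ≤ y) :
    volCDF A y ≤ volCDF A x + (y - x) := by
  have h : volume (A ∩ Iic y) ≤ volume (A ∩ Iic x) + ENNReal.ofReal (y - x) := by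
    rw [← Real.volume_Ioc]
    refine (measure_mono ?_).trans (measure_union_le _ _)
    rintro z ⟨hz, hzy⟩
    rcases le_or_gt z x with h | h
    · exact Or.inl ⟨hz, h⟩
    · exact Or.inr ⟨h, hzy⟩
  have h2 := ENNReal.toReal_mono
    (ENNReal.add_ne_top.2 ⟨volume_inter_Iic_ne_top hA x, ENNReal.ofReal_ne_top⟩) h
  rwa [ENNReal.toReal_add (volume_inter_Iic_ne_top hA x) ENNReal.ofReal_ne_top,
    ENNReal.toReal_ofReal (by linarith)] at h2

lemma volCDF_continuous {A : Set ℝ} (hA : volume A ≠ ∞) : Continuous (volCDF A) := by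
  refine (LipschitzWith.of_le_add (fun x y => ?_)).continuous
  rcases le_total x y with h | h
  · exact (volCDF_mono hA h).trans (by linarith [dist_nonneg (x := x) (y := y)])
  · rw [Real.dist_eq, abs_of_nonneg (by linarith)]
    exact volCDF_le_add hA h

lemma exists_lt_volCDF {A : Set ℝ} (hA : volume A ≠ ∞) {s : ℝ}
    (hs : s < (volume A).toReal) : ∃ x, s < volCDF A x := by
  have h := tendsto_measure_Iic_atTop (volume.restrict A)
  simp only [Measure.restrict_apply measurableSet_Iic, Measure.restrict_apply_univ] at h
  have h2 := (ENNReal.tendsto_toReal hA).comp h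
  obtain ⟨x, hx⟩ := (h2.eventually (lt_mem_nhds hs)).exists
  exact ⟨x, by simpa [volCDF, inter_comm] using hx⟩

lemma exists_volCDF_lt {A : Set ℝ} (hm : MeasurableSet A) (hA : volume A ≠ ∞) {s : ℝ}
    (hs : 0 < s) : ∃ x, volCDF A x < s := by
  have h := tendsto_measure_Ici_atBot (volume.restrict A)
  simp only [Measure.restrict_apply measurableSet_Ici, Measure.restrict_apply_univ] at h
  have h2 := (ENNReal.tendsto_toReal hA).comp h
  obtain ⟨x, hx⟩ := (h2.eventually (lt_mem_nhds (sub_lt_self _ hs))).exists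
  refine ⟨x - 1, ?_⟩
  have hd : volume (A ∩ Iic (x - 1)) + volume (Ici x ∩ A) ≤ volume A := by
    rw [← measure_union _ (measurableSet_Ici.inter hm)]
    · exact measure_mono (union_subset inter_subset_left inter_subset_right)
    · rw [Set.disjoint_left]
      rintro z ⟨-, hz⟩ ⟨hz', -⟩
      simp only [mem_Iic, mem_Ici] at hz hz'
      linarith
  have h3 : volume (Ici x ∩ A) ≠ ∞ := ne_top_of_le_ne_top hA (measure_mono inter_subset_right)
  have h4 := ENNReal.toReal_mono hA hd
  rw [ENNReal.toReal_add (volume_inter_Iic_ne_top hA _) h3] at h4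
  simp only [Function.comp_apply] at hx
  simp only [volCDF]
  linarith

lemma volCDF_le {A : Set ℝ} (hA : volume A ≠ ∞) (x : ℝ) : volCDF A x ≤ (volume A).toReal :=
  ENNReal.toReal_mono hA (measure_mono inter_subset_left)

/-- A quantile function of the restriction of Lebesgue measure to `A`. -/
lemma exists_quantile {A : Set ℝ} (hm : MeasurableSet A) (hA : volume A ≠ ∞) :
    ∃ q : ℝ → ℝ, Measurable q ∧
      (∀ s ∈ Ioo 0 (volume A).toReal, ∀ x, s ≤ volCDF A x ↔ q s ≤ x) ∧
      (∀ s ∈ Ioo 0 (volume A).toReal, volCDF A (q s) = s) ∧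
      (volume.restrict (Ioo 0 (volume A).toReal)).map q = volume.restrict A := by
  classical
  set a := (volume A).toReal with ha
  let q : ℝ → ℝ := fun s => if s ∈ Ioo 0 a then sInf {x | s ≤ volCDF A x} else 0
  have hclosed : ∀ s, IsClosed {x | s ≤ volCDF A x} := fun s =>
    isClosed_le continuous_const (volCDF_continuous hA)
  have hne : ∀ s ∈ Ioo 0 a, {x | s ≤ volCDF A x}.Nonempty := fun s hs => by
    obtain ⟨x, hx⟩ := exists_lt_volCDF hA hs.2
    exact ⟨x, hx.le⟩
  have hbdd : ∀ s ∈ Ioo 0 a, BddBelow {x | s ≤ volCDF A x} := fun s hs => by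
    obtain ⟨x, hx⟩ := exists_volCDF_lt hm hA hs.1
    refine ⟨x, fun y hy => ?_⟩
    by_contra! h
    have := volCDF_mono hA h.le
    simp only [mem_ofPred_eq] at hy
    linarith
  have hiff : ∀ s ∈ Ioo 0 a, ∀ x, s ≤ volCDF A x ↔ q s ≤ x := by
    intro s hs x
    simp only [q, if_pos hs]
    refine ⟨fun h => csInf_le (hbdd s hs) h, fun h => ?_⟩
    exact ((hclosed s).csInf_mem (hne s hs) (hbdd s hs)).out.trans (volCDF_mono hA h)
  have hinv : ∀ s ∈ Ioo 0 a, volCDF A (q s) = s := by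
    intro s hs
    refine le_antisymm ?_ ((hiff s hs _).2 le_rfl)
    refine le_of_forall_pos_le_add fun ε hε => ?_
    have h1 : ¬ s ≤ volCDF A (q s - ε) := fun h => by
      have := (hiff s hs _).1 h
      linarith
    have := volCDF_le_add hA (x := q s - ε) (y := q s) (by linarith)
    linarith
  have hq : Measurable q := by
    refine measurable_of_Iic fun x => ?_
    have : q ⁻¹' Iic x = (Ioo 0 a ∩ Iic (volCDF A x)) ∪ ((Ioo 0 a)ᶜ ∩ {_s | 0 ≤ x}) := by
      ext s
      by_cases hs : s ∈ Ioo 0 a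
      · have := hiff s hs x
        simp only [mem_preimage, mem_Iic, mem_union, mem_inter_iff, hs, true_and, mem_compl_iff,
          not_true_eq_false, false_and, or_false, this]
      · simp only [mem_preimage, mem_Iic, mem_union, mem_inter_iff, hs, false_and, mem_compl_iff,
          not_false_eq_true, true_and, false_or, mem_ofPred_eq, q, if_false]
    rw [this]
    exact (measurableSet_Ioo.inter measurableSet_Iic).union
      (measurableSet_Ioo.compl.inter (MeasurableSet.const _))
  refine ⟨q, hq, hiff, hinv, ?_⟩
  have : IsFiniteMeasure ((volume.restrict (Ioo 0 a)).map q) := inferInstance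
  refine Measure.ext_of_Iic _ _ fun x => ?_
  rw [Measure.map_apply hq measurableSet_Iic, Measure.restrict_apply (hq measurableSet_Iic),
    Measure.restrict_apply measurableSet_Iic, inter_comm (Iic x)]
  have h1 : q ⁻¹' Iic x ∩ Ioo 0 a = Ioo 0 a ∩ Iic (volCDF A x) := by
    ext s
    by_cases hs : s ∈ Ioo 0 a
    · simp [hs, hiff s hs x]
    · simp [hs]
  rw [h1]
  have h2 : volume (A ∩ Iic x) = ENNReal.ofReal (volCDF A x) :=
    (ENNReal.ofReal_toReal (volume_inter_Iic_ne_top hA x)).symm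
  rw [h2]
  have h3 := volCDF_le hA x
  refine le_antisymm ?_ ?_
  · calc volume (Ioo 0 a ∩ Iic (volCDF A x)) ≤ volume (Ioc 0 (volCDF A x)) :=
          measure_mono (by rintro s ⟨hs, hs'⟩; exact ⟨hs.1, hs'⟩)
      _ = _ := by rw [Real.volume_Ioc, sub_zero]
  · calc ENNReal.ofReal (volCDF A x) = volume (Ioo 0 (volCDF A x)) := by
          rw [Real.volume_Ioo, sub_zero]
      _ ≤ _ := measure_mono (by rintro s hs; exact ⟨⟨hs.1, hs.2.trans_le h3⟩, hs.2.le⟩)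

/-- Pushing `A` forward by its distribution function gives an interval. -/
lemma volume_inter_volCDF_preimage {A : Set ℝ} (hm : MeasurableSet A) (hA : volume A ≠ ∞)
    {S : Set ℝ} (hS : MeasurableSet S) :
    volume (A ∩ volCDF A ⁻¹' S) = volume (Ioo 0 (volume A).toReal ∩ S) := by
  obtain ⟨q, hq, -, hinv, hmap⟩ := exists_quantile hm hA
  have hF : Measurable (volCDF A) := (volCDF_continuous hA).measurable
  rw [inter_comm, ← Measure.restrict_apply (hF hS), ← hmap, Measure.map_apply hq (hF hS),
    Measure.restrict_apply (hq (hF hS)), inter_comm]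
  congr 1
  ext s
  constructor
  · rintro ⟨hs, h⟩
    exact ⟨hs, by simpa [hinv s hs] using h⟩
  · rintro ⟨hs, h⟩
    exact ⟨hs, by simpa [hinv s hs] using h⟩

/-- The trilinear form of the Riesz rearrangement inequality, evaluated on sets. -/
noncomputable def rieszForm {E : Type*} [MeasureSpace E] [Sub E] (X Y Z : Set E) : ℝ≥0∞ :=
  (volume.prod volume) {p : E × E | p.1 ∈ X ∧ p.2 ∈ Y ∧ p.1 - p.2 ∈ Z}

lemma measurableSet_rieszForm {E : Type*} [MeasurableSpace E] [Sub E] [MeasurableSub₂ E]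
    {X Y Z : Set E} (hX : MeasurableSet X) (hY : MeasurableSet Y) (hZ : MeasurableSet Z) :
    MeasurableSet {p : E × E | p.1 ∈ X ∧ p.2 ∈ Y ∧ p.1 - p.2 ∈ Z} :=
  (measurable_fst hX).inter ((measurable_snd hY).inter ((measurable_fst.sub measurable_snd) hZ))

lemma rieszForm_eq_lintegral {E : Type*} [MeasureSpace E] [Sub E] [MeasurableSub₂ E]
    [SFinite (volume : Measure E)]
    {X Y Z : Set E} (hX : MeasurableSet X) (hY : MeasurableSet Y) (hZ : MeasurableSet Z) :
    rieszForm X Y Z = ∫⁻ x in X, volume {y | y ∈ Y ∧ x - y ∈ Z} := by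
  rw [rieszForm, Measure.prod_apply (measurableSet_rieszForm hX hY hZ), ← lintegral_indicator hX]
  refine lintegral_congr fun x => ?_
  by_cases hx : x ∈ X
  · simp [hx]
  · simp [hx]

lemma rieszForm_univ {E : Type*} [MeasureSpace E] [AddGroup E] [MeasurableAdd₂ E] [MeasurableNeg E]
    [SFinite (volume : Measure E)] [(volume : Measure E).IsAddRightInvariant]
    {Y Z : Set E} (hY : MeasurableSet Y) (hZ : MeasurableSet Z) :
    rieszForm univ Y Z = volume Z * volume Y := by
  have h := (measurePreserving_sub_prod (volume : Measure E) volume).measure_preimage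
    (hZ.prod hY).nullMeasurableSet
  rw [Measure.prod_prod] at h
  rw [← h, rieszForm]
  congr 1
  ext p
  simp [and_comm]

lemma measurable_volume_section {E : Type*} [MeasureSpace E] [Sub E] [MeasurableSub₂ E]
    [SFinite (volume : Measure E)] {Y Z : Set E} (hY : MeasurableSet Y) (hZ : MeasurableSet Z) :
    Measurable fun x => volume {y | y ∈ Y ∧ x - y ∈ Z} := by
  have h := measurable_measure_prodMk_left (ν := (volume : Measure E))
    (measurableSet_rieszForm .univ hY hZ)
  simpa using h

lemma lintegral_sub_add_sub {a b t : ℝ} (hta : t ≤ a) (htb : t ≤ b) (ht : 0 ≤ t) :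
    ∫⁻ s in Ioo 0 t, (ENNReal.ofReal (b - s) + ENNReal.ofReal (a - s))
      = ENNReal.ofReal (t * (a + b) - t ^ 2) := by
  have h1 : ∫⁻ s in Ioo 0 t, (ENNReal.ofReal (b - s) + ENNReal.ofReal (a - s))
      = ∫⁻ s in Ioo 0 t, ENNReal.ofReal (b + a - 2 * s) := by
    refine setLIntegral_congr_fun measurableSet_Ioo fun s hs => ?_
    have := hs.2
    rw [← ENNReal.ofReal_add (by linarith) (by linarith)]
    congr 1; ring
  have hc : Continuous fun s : ℝ => b + a - 2 * s := by fun_prop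
  rw [h1, ← ofReal_integral_eq_lintegral_ofReal]
  · rw [← integral_Ioc_eq_integral_Ioo, ← intervalIntegral.integral_of_le ht]
    congr 1
    rw [intervalIntegral.integral_sub (by simp)
      ((continuous_const_mul 2).intervalIntegrable _ _),
      intervalIntegral.integral_const, intervalIntegral.integral_const_mul, integral_id,
      smul_eq_mul]
    ring
  · exact (hc.integrableOn_Icc (a := 0) (b := t)).mono_set Ioo_subset_Icc_self
  · refine (ae_restrict_iff' measurableSet_Ioo).2 (.of_forall fun s hs => ?_)
    have := hs.2
    simp only [Pi.zero_apply]
    linarith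

/-- A continuous form of Pollard's inequality on the line. -/
lemma rieszForm_add_le {A B C : Set ℝ} (hAm : MeasurableSet A) (hBm : MeasurableSet B)
    (hCm : MeasurableSet C) (hA : volume A ≠ ∞) (hB : volume B ≠ ∞)
    {t : ℝ} (ht : 0 ≤ t) (hta : t ≤ (volume A).toReal) (htb : t ≤ (volume B).toReal) :
    rieszForm C B A +
        ENNReal.ofReal (t * ((volume A).toReal + (volume B).toReal) - t ^ 2) ≤
      volume A * volume B + ENNReal.ofReal t * volume C := by
  obtain ⟨qA, hqA, hiffA, hinvA, hmapA⟩ := exists_quantile hAm hA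
  obtain ⟨qB, hqB, hiffB, hinvB, hmapB⟩ := exists_quantile hBm hB
  set a := (volume A).toReal with ha
  set b := (volume B).toReal with hb
  have hFA : Measurable (volCDF A) := (volCDF_continuous hA).measurable
  have hFB : Measurable (volCDF B) := (volCDF_continuous hB).measurable
  let N1 : Set (ℝ × ℝ) := {p | p.2 ∈ Ioo 0 t ∧ p.1 - qA p.2 ∈ B ∧
    volCDF B (p.1 - qA p.2) < b - p.2}
  let N2 : Set (ℝ × ℝ) := {p | p.2 ∈ Ioo 0 t ∧ p.1 - qB (b - p.2) ∈ A ∧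
    p.2 ≤ volCDF A (p.1 - qB (b - p.2))}
  have hg1 : Measurable fun p : ℝ × ℝ => p.1 - qA p.2 := by fun_prop
  have hg2 : Measurable fun p : ℝ × ℝ => p.1 - qB (b - p.2) := by fun_prop
  have hN1 : MeasurableSet N1 := (measurable_snd measurableSet_Ioo).inter
    ((hg1 hBm).inter (measurableSet_lt (hFB.comp hg1) (by fun_prop)))
  have hN2 : MeasurableSet N2 := (measurable_snd measurableSet_Ioo).inter
    ((hg2 hAm).inter (measurableSet_le (by fun_prop) (hFA.comp hg2)))
  let μ : ℝ → ℝ≥0∞ := fun z => volume (Prod.mk z ⁻¹' N1) + volume (Prod.mk z ⁻¹' N2)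
  let f : ℝ → ℝ≥0∞ := fun z => volume {y | y ∈ B ∧ z - y ∈ A}
  have hμt : ∀ z, μ z ≤ ENNReal.ofReal t := by
    intro z
    have hd : Disjoint (Prod.mk z ⁻¹' N1) (Prod.mk z ⁻¹' N2) := by
      rw [Set.disjoint_left]
      rintro s ⟨hs, -, h1⟩ ⟨-, -, h2⟩
      simp only [mem_Ioo] at hs h1 h2
      have h3 : z - qA s < qB (b - s) := by
        by_contra! h
        exact absurd ((hiffB (b - s) ⟨by linarith, by linarith⟩ _).2 h) (not_le.2 h1)
      have h4 := (hiffA s ⟨hs.1, by linarith⟩ _).1 h2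
      linarith
    have : μ z = volume (Prod.mk z ⁻¹' N1 ∪ Prod.mk z ⁻¹' N2) :=
      (measure_union hd (measurable_prodMk_left hN2)).symm
    rw [this]
    calc _ ≤ volume (Ioo 0 t) := measure_mono (by rintro s (h | h) <;> exact h.1)
      _ = _ := by rw [Real.volume_Ioo, sub_zero]
  have hμf : ∀ z, μ z ≤ f z := by
    intro z
    let M1 : Set ℝ := {x | volCDF A x ∈ Ioo 0 t ∧ z - x ∈ B ∧ volCDF B (z - x) < b - volCDF A x}
    let M2 : Set ℝ := {y | b - volCDF B y ∈ Ioo 0 t ∧ z - y ∈ A ∧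
      b - volCDF B y ≤ volCDF A (z - y)}
    have hz : Measurable fun x : ℝ => z - x := by fun_prop
    have hM1 : MeasurableSet M1 := (hFA measurableSet_Ioo).inter
      ((hz hBm).inter (measurableSet_lt (hFB.comp hz) (by fun_prop)))
    have hM2 : MeasurableSet M2 := ((measurable_const.sub hFB) measurableSet_Ioo).inter
      ((hz hAm).inter (measurableSet_le (by fun_prop) (hFA.comp hz)))
    have e1 : volume (Prod.mk z ⁻¹' N1) = volume ((fun y => z - y) ⁻¹' (M1 ∩ A)) := by
      rw [(Measure.measurePreserving_sub_left volume z).measure_preimage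
          (hM1.inter hAm).nullMeasurableSet, ← Measure.restrict_apply hM1, ← hmapA,
        Measure.map_apply hqA hM1, Measure.restrict_apply (hqA hM1)]
      congr 1
      ext s
      constructor
      · rintro ⟨hs, h⟩
        have hs' : s ∈ Ioo 0 a := ⟨hs.1, hs.2.trans_le hta⟩
        refine ⟨⟨?_, h.1, ?_⟩, hs'⟩
        · rw [hinvA s hs']; exact hs
        · rw [hinvA s hs']; exact h.2
      · rintro ⟨⟨h1, h2, h3⟩, hs⟩
        rw [hinvA s hs] at h1 h3
        exact ⟨h1, h2, h3⟩
    have e2 : volume (Prod.mk z ⁻¹' N2) = volume (M2 ∩ B) := by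
      rw [← Measure.restrict_apply hM2, ← hmapB, Measure.map_apply hqB hM2,
        Measure.restrict_apply (hqB hM2),
        ← (Measure.measurePreserving_sub_left volume b).measure_preimage
          ((hqB hM2).inter measurableSet_Ioo).nullMeasurableSet]
      congr 1
      ext s
      constructor
      · rintro ⟨hs, h⟩
        simp only [mem_Ioo] at hs h
        have hs' : b - s ∈ Ioo 0 b := ⟨by linarith, by linarith⟩
        refine ⟨⟨?_, h.1, ?_⟩, hs'⟩
        · rw [hinvB _ hs', sub_sub_cancel]; exact hs
        · rw [hinvB _ hs', sub_sub_cancel]; exact h.2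
      · rintro ⟨⟨h1, h2, h3⟩, hs⟩
        rw [hinvB _ hs, sub_sub_cancel] at h1 h3
        exact ⟨h1, h2, h3⟩
    have hd : Disjoint ((fun y => z - y) ⁻¹' (M1 ∩ A)) (M2 ∩ B) := by
      rw [Set.disjoint_left]
      rintro y ⟨⟨-, -, h1⟩, -⟩ ⟨⟨-, -, h2⟩, -⟩
      rw [sub_sub_cancel] at h1
      linarith
    have : μ z = volume ((fun y => z - y) ⁻¹' (M1 ∩ A) ∪ (M2 ∩ B)) := by
      rw [measure_union hd (hM2.inter hBm), ← e1, ← e2]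
    rw [this]
    refine measure_mono ?_
    rintro y (⟨⟨-, h1, -⟩, h2⟩ | ⟨⟨-, h1, -⟩, h2⟩)
    · rw [sub_sub_cancel] at h1
      exact ⟨h1, h2⟩
    · exact ⟨h2, h1⟩
  have hμ : ENNReal.ofReal (t * (a + b) - t ^ 2) ≤ ∫⁻ z, μ z := by
    have hm1 : Measurable fun z => volume (Prod.mk z ⁻¹' N1) := measurable_measure_prodMk_left hN1
    simp only [μ]
    rw [lintegral_add_left hm1, ← Measure.prod_apply hN1, ← Measure.prod_apply hN2,
      Measure.prod_apply_symm hN1, Measure.prod_apply_symm hN2,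
      ← lintegral_add_left (measurable_measure_prodMk_right hN1),
      ← lintegral_sub_add_sub hta htb ht, ← lintegral_indicator measurableSet_Ioo]
    refine lintegral_mono fun s => ?_
    by_cases hs : s ∈ Ioo 0 t
    swap
    · simp [hs]
    rw [indicator_of_mem hs]
    have hs1 := hs.1
    have hs2 := hs.2
    have e1 : (fun z => (z, s)) ⁻¹' N1 =
        (fun z => z - qA s) ⁻¹' (B ∩ volCDF B ⁻¹' Iio (b - s)) := by
      ext z
      exact ⟨fun h => h.2, fun h => ⟨hs, h⟩⟩
    have e2 : (fun z => (z, s)) ⁻¹' N2 =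
        (fun z => z - qB (b - s)) ⁻¹' (A ∩ volCDF A ⁻¹' Ici s) := by
      ext z
      exact ⟨fun h => h.2, fun h => ⟨hs, h⟩⟩
    rw [e1, e2, (measurePreserving_sub_right volume (qA s)).measure_preimage
        (hBm.inter (hFB measurableSet_Iio)).nullMeasurableSet,
      (measurePreserving_sub_right volume (qB (b - s))).measure_preimage
        (hAm.inter (hFA measurableSet_Ici)).nullMeasurableSet,
      volume_inter_volCDF_preimage hAm hA measurableSet_Ici,
      volume_inter_volCDF_preimage hBm hB measurableSet_Iio]
    refine add_le_add ?_ ?_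
    · calc ENNReal.ofReal (b - s) = volume (Ioo 0 (b - s)) := by rw [Real.volume_Ioo, sub_zero]
        _ ≤ _ := measure_mono (by rintro x hx; exact ⟨⟨hx.1, by linarith [hx.2]⟩, hx.2⟩)
    · calc ENNReal.ofReal (a - s) = volume (Ioo s a) := by rw [Real.volume_Ioo]
        _ ≤ _ := measure_mono (by rintro x hx; exact ⟨⟨by linarith [hx.1], hx.2⟩, hx.1.le⟩)
  calc rieszForm C B A + ENNReal.ofReal (t * (a + b) - t ^ 2)
      ≤ (∫⁻ z in C, f z) + ∫⁻ z, μ z := add_le_add (rieszForm_eq_lintegral hCm hBm hAm).le hμ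
    _ = (∫⁻ z in C, f z) + ((∫⁻ z in C, μ z) + ∫⁻ z in Cᶜ, μ z) := by
        rw [lintegral_add_compl _ hCm]
    _ ≤ (∫⁻ z in C, f z) + ((∫⁻ _ in C, ENNReal.ofReal t) + ∫⁻ z in Cᶜ, f z) := by
        gcongr with z z
        · exact hμt z
        · exact hμf z
    _ = (∫⁻ z in univ, f z) + ENNReal.ofReal t * volume C := by
        rw [setLIntegral_const, setLIntegral_univ, add_left_comm, add_comm,
          lintegral_add_compl f hCm]
    _ = _ := by
        rw [← rieszForm_eq_lintegral .univ hBm hAm, rieszForm_univ hBm hAm]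

lemma rieszForm_mono {E : Type*} [MeasureSpace E] [Sub E] {X Y Z X' Y' Z' : Set E}
    (hX : X ⊆ X') (hY : Y ⊆ Y') (hZ : Z ⊆ Z') : rieszForm X Y Z ≤ rieszForm X' Y' Z' :=
  measure_mono fun _ h => ⟨hX h.1, hY h.2.1, hZ h.2.2⟩

lemma rieszForm_le_mul {E : Type*} [MeasureSpace E] [Sub E] [SFinite (volume : Measure E)]
    {X Y Z : Set E} : rieszForm X Y Z ≤ volume X * volume Y := by
  rw [← Measure.prod_prod]
  exact measure_mono fun _ h => ⟨h.1, h.2.1⟩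

lemma rieszForm_le_mul' {E : Type*} [MeasureSpace E] [AddGroup E] [MeasurableAdd₂ E]
    [MeasurableNeg E] [SFinite (volume : Measure E)] [(volume : Measure E).IsAddRightInvariant]
    {X Y Z : Set E} (hY : MeasurableSet Y) (hZ : MeasurableSet Z) :
    rieszForm X Y Z ≤ volume Z * volume Y := by
  rw [← rieszForm_univ hY hZ]
  exact rieszForm_mono (subset_univ _) subset_rfl subset_rfl

lemma rieszForm_univ_mid {X Z : Set ℝ} (hX : MeasurableSet X) (hZ : MeasurableSet Z) :
    rieszForm X univ Z = volume X * volume Z := by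
  rw [rieszForm_eq_lintegral hX .univ hZ]
  have : ∀ x : ℝ, volume {y | y ∈ (univ : Set ℝ) ∧ x - y ∈ Z} = volume Z := by
    intro x
    rw [← (Measure.measurePreserving_sub_left volume x).measure_preimage hZ.nullMeasurableSet]
    simp [preimage]
  simp_rw [this]
  rw [setLIntegral_const, mul_comm]

/-- The open interval centred at `0` with prescribed length. -/
def centeredInterval (α : ℝ≥0∞) : Set ℝ := {t | ENNReal.ofReal (2 * |t|) < α}

lemma centeredInterval_mono {α β : ℝ≥0∞} (h : α ≤ β) : centeredInterval α ⊆ centeredInterval β :=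
  fun _ ht => lt_of_lt_of_le (show ENNReal.ofReal _ < α from ht) h

lemma centeredInterval_eq_Ioo {α : ℝ≥0∞} (h : α ≠ ∞) :
    centeredInterval α = Ioo (-(α.toReal / 2)) (α.toReal / 2) := by
  ext t
  rw [mem_Ioo, ← abs_lt, centeredInterval, mem_ofPred_eq,
    ENNReal.ofReal_lt_iff_lt_toReal (by positivity) h]
  constructor <;> intro h <;> linarith

lemma measurableSet_centeredInterval (α : ℝ≥0∞) : MeasurableSet (centeredInterval α) :=
  measurableSet_lt (by fun_prop) measurable_const

lemma volume_centeredInterval (α : ℝ≥0∞) : volume (centeredInterval α) = α := by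
  by_cases h : α = ∞
  · have : centeredInterval α = univ := by
      ext t
      simp only [centeredInterval, h, mem_ofPred_eq, ENNReal.ofReal_lt_top, mem_univ]
    rw [this, h, Real.volume_univ]
  · rw [centeredInterval_eq_Ioo h, Real.volume_Ioo, show α.toReal / 2 - -(α.toReal / 2) = α.toReal
      by ring, ENNReal.ofReal_toReal h]

lemma lintegral_Ici_sub {κ u : ℝ} (h : κ ≤ u) :
    ∫⁻ x in Ici κ, ENNReal.ofReal (u - x) = ENNReal.ofReal ((u - κ) ^ 2 / 2) := by
  have h1 : ∫⁻ x in Ici κ, ENNReal.ofReal (u - x) = ∫⁻ x in Ioc κ u, ENNReal.ofReal (u - x) := by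
    rw [setLIntegral_congr Ioi_ae_eq_Ici.symm, ← lintegral_indicator measurableSet_Ioi,
      ← lintegral_indicator measurableSet_Ioc]
    refine lintegral_congr fun x => ?_
    by_cases hx : x ∈ Ioc κ u
    · rw [indicator_of_mem hx, indicator_of_mem (show x ∈ Ioi κ from hx.1)]
    · rw [indicator_of_notMem hx]
      by_cases hx' : x ∈ Ioi κ
      · rw [indicator_of_mem hx', ENNReal.ofReal_eq_zero]
        by_contra! h
        exact hx ⟨hx', by linarith⟩
      · rw [indicator_of_notMem hx']
  have hc : Continuous fun x : ℝ => u - x := by fun_prop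
  rw [h1, ← ofReal_integral_eq_lintegral_ofReal]
  · rw [← intervalIntegral.integral_of_le h]
    congr 1
    rw [intervalIntegral.integral_sub (by simp) (continuous_id'.intervalIntegrable _ _),
      intervalIntegral.integral_const, integral_id, smul_eq_mul]
    ring
  · exact (hc.integrableOn_Icc (a := κ) (b := u)).mono_set Ioc_subset_Icc_self
  · refine (ae_restrict_iff' measurableSet_Ioc).2 (.of_forall fun s hs => ?_)
    have := hs.2
    simp only [Pi.zero_apply]
    linarith

lemma rieszForm_Ioo_compl_le {a b c : ℝ} (h : c ≤ a + b) :
    rieszForm (Ioo (-(c / 2)) (c / 2))ᶜ (Ioo (-(b / 2)) (b / 2)) (Ioo (-(a / 2)) (a / 2)) ≤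
      ENNReal.ofReal (((a + b - c) / 2) ^ 2) := by
  rw [rieszForm_eq_lintegral measurableSet_Ioo.compl measurableSet_Ioo measurableSet_Ioo]
  have hf1 : ∀ x : ℝ, volume {y | y ∈ Ioo (-(b / 2)) (b / 2) ∧ x - y ∈ Ioo (-(a / 2)) (a / 2)} ≤
      ENNReal.ofReal ((a + b) / 2 - x) := by
    intro x
    calc _ ≤ volume (Ioo (x - a / 2) (b / 2)) :=
          measure_mono (by rintro y ⟨⟨h1, h2⟩, h3, h4⟩; constructor <;> linarith)
      _ = _ := by rw [Real.volume_Ioo]; congr 1; ring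
  have hf2 : ∀ x : ℝ, volume {y | y ∈ Ioo (-(b / 2)) (b / 2) ∧ x - y ∈ Ioo (-(a / 2)) (a / 2)} ≤
      ENNReal.ofReal ((a + b) / 2 - -x) := by
    intro x
    calc _ ≤ volume (Ioo (-(b / 2)) (x + a / 2)) :=
          measure_mono (by rintro y ⟨⟨h1, h2⟩, h3, h4⟩; constructor <;> linarith)
      _ = _ := by rw [Real.volume_Ioo]; congr 1; ring
  have hu : (Ioo (-(c / 2)) (c / 2))ᶜ ⊆ Ici (c / 2) ∪ Neg.neg ⁻¹' Ici (c / 2) := by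
    intro x hx
    simp only [mem_compl_iff, mem_Ioo, not_and_or, not_lt] at hx
    rcases hx with hx | hx
    · right; simp only [mem_preimage, mem_Ici]; linarith
    · left; exact hx
  have hneg := (Measure.measurePreserving_neg (volume : Measure ℝ)).setLIntegral_comp_preimage_emb
    (MeasurableEquiv.neg ℝ).measurableEmbedding (fun x => ENNReal.ofReal ((a + b) / 2 - x))
    (Ici (c / 2))
  have hI := lintegral_Ici_sub (κ := c / 2) (u := (a + b) / 2) (by linarith)
  calc _ ≤ ∫⁻ x in Ici (c / 2) ∪ Neg.neg ⁻¹' Ici (c / 2),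
          volume {y | y ∈ Ioo (-(b / 2)) (b / 2) ∧ x - y ∈ Ioo (-(a / 2)) (a / 2)} :=
        lintegral_mono_set hu
    _ ≤ _ := lintegral_union_le _ _ _
    _ ≤ (∫⁻ x in Ici (c / 2), ENNReal.ofReal ((a + b) / 2 - x)) +
          ∫⁻ x in Neg.neg ⁻¹' Ici (c / 2), ENNReal.ofReal ((a + b) / 2 - -x) :=
        add_le_add (lintegral_mono hf1) (lintegral_mono hf2)
    _ = _ := by
        rw [hneg, hI, ← ENNReal.ofReal_add (by positivity) (by positivity)]
        congr 1
        ring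

/-- The one-dimensional Riesz rearrangement inequality for sets. -/
lemma rieszForm_le_centeredInterval {A B C : Set ℝ} (hAm : MeasurableSet A) (hBm : MeasurableSet B)
    (hCm : MeasurableSet C) (hA : volume A ≠ ∞) (hB : volume B ≠ ∞) (hC : volume C ≠ ∞) :
    rieszForm C B A ≤ rieszForm (centeredInterval (volume C)) (centeredInterval (volume B))
      (centeredInterval (volume A)) := by
  have hAv := volume_centeredInterval (volume A)
  have hBv := volume_centeredInterval (volume B)
  have hCv := volume_centeredInterval (volume C)
  have hAs := measurableSet_centeredInterval (volume A)
  have hBs := measurableSet_centeredInterval (volume B)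
  have hCs := measurableSet_centeredInterval (volume C)
  set a := (volume A).toReal with ha
  set b := (volume B).toReal with hb
  set c := (volume C).toReal with hc
  have ha0 : 0 ≤ a := ENNReal.toReal_nonneg
  have hb0 : 0 ≤ b := ENNReal.toReal_nonneg
  have hc0 : 0 ≤ c := ENNReal.toReal_nonneg
  have hAI := centeredInterval_eq_Ioo hA
  have hBI := centeredInterval_eq_Ioo hB
  have hCI := centeredInterval_eq_Ioo hC
  rw [← ha] at hAI
  rw [← hb] at hBI
  rw [← hc] at hCI
  have hAB := rieszForm_univ hBs hAs
  rw [hAv, hBv] at hAB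
  by_cases h1 : a + b ≤ c
  · refine (rieszForm_le_mul' hBm hAm).trans (hAB.symm.le.trans (measure_mono ?_))
    rintro p ⟨-, h2, h3⟩
    refine ⟨?_, h2, h3⟩
    rw [hBI] at h2
    rw [hAI] at h3
    rw [hCI]
    constructor <;> linarith [h2.1, h2.2, h3.1, h3.2]
  by_cases h2 : b + c ≤ a
  · have hCB : (volume.prod volume) (centeredInterval (volume C) ×ˢ centeredInterval (volume B))
        = volume C * volume B := by rw [Measure.prod_prod, hBv, hCv]
    refine rieszForm_le_mul.trans (hCB.symm.le.trans (measure_mono ?_))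
    rintro p ⟨h3, h4⟩
    refine ⟨h3, h4, ?_⟩
    rw [hBI] at h4
    rw [hCI] at h3
    rw [hAI]
    constructor <;> linarith [h4.1, h4.2, h3.1, h3.2]
  by_cases h3 : a + c ≤ b
  · have hCA := rieszForm_univ_mid hCs hAs
    rw [hCv, hAv] at hCA
    refine (rieszForm_mono subset_rfl (subset_univ _) subset_rfl).trans
      ((rieszForm_univ_mid hCm hAm).le.trans (hCA.symm.le.trans (measure_mono ?_)))
    rintro p ⟨h4, -, h5⟩
    refine ⟨h4, ?_, h5⟩
    rw [hAI] at h5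
    rw [hCI] at h4
    rw [hBI]
    constructor <;> linarith [h4.1, h4.2, h5.1, h5.2]
  push Not at h1 h2 h3
  have key := rieszForm_add_le hAm hBm hCm hA hB (t := (a + b - c) / 2) (by linarith)
    (by linarith) (by linarith)
  rw [← ha, ← hb] at key
  have hcompl := rieszForm_Ioo_compl_le (a := a) (b := b) (c := c) h1.le
  rw [← hAI, ← hBI, ← hCI] at hcompl
  have hsplit : volume A * volume B = rieszForm (centeredInterval (volume C))
      (centeredInterval (volume B)) (centeredInterval (volume A)) +
      rieszForm (centeredInterval (volume C))ᶜ
      (centeredInterval (volume B)) (centeredInterval (volume A)) := by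
    rw [← hAB, rieszForm_eq_lintegral .univ hBs hAs, rieszForm_eq_lintegral hCs hBs hAs,
      rieszForm_eq_lintegral hCs.compl hBs hAs, lintegral_add_compl _ hCs, setLIntegral_univ]
  have hfin : ENNReal.ofReal (((a + b - c) / 2) * (a + b) - ((a + b - c) / 2) ^ 2) ≠ ∞ :=
    ENNReal.ofReal_ne_top
  rw [← ENNReal.add_le_add_iff_right hfin]
  refine key.trans ?_
  rw [hsplit, add_assoc]
  refine add_le_add le_rfl ((add_le_add hcompl le_rfl).trans ?_)
  have hCr : volume C = ENNReal.ofReal c := (ENNReal.ofReal_toReal hC).symm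
  rw [hCr, ← ENNReal.ofReal_mul (by linarith),
    ← ENNReal.ofReal_add (by positivity) (mul_nonneg (by linarith) hc0)]
  refine ENNReal.ofReal_le_ofReal ?_
  nlinarith

/-- Steiner symmetrization of a subset of `ℝ × W` in the direction of the first factor. -/
def steiner {W : Type*} (A : Set (ℝ × W)) : Set (ℝ × W) :=
  {p | p.1 ∈ centeredInterval (volume ((fun t : ℝ => (t, p.2)) ⁻¹' A))}

lemma steiner_section {W : Type*} (A : Set (ℝ × W)) (w : W) :
    (fun t : ℝ => (t, w)) ⁻¹' steiner A =
      centeredInterval (volume ((fun t : ℝ => (t, w)) ⁻¹' A)) := rfl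

lemma steiner_subset {W : Type*} {A D : Set (ℝ × W)} (h : A ⊆ D)
    (hD : ∀ w, ∃ δ, (fun t : ℝ => (t, w)) ⁻¹' D = centeredInterval δ) : steiner A ⊆ D := by
  rintro ⟨t, w⟩ ht
  obtain ⟨δ, hδ⟩ := hD w
  change t ∈ (fun t : ℝ => (t, w)) ⁻¹' D
  have h1 : volume ((fun t : ℝ => (t, w)) ⁻¹' A) ≤ δ := by
    rw [← volume_centeredInterval δ, ← hδ]
    exact measure_mono (preimage_mono h)
  rw [hδ]
  exact centeredInterval_mono h1 ht

section Steiner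

variable {W : Type*} [MeasureSpace W]

lemma measurableSet_steiner {A : Set (ℝ × W)} (hA : MeasurableSet A) :
    MeasurableSet (steiner A) :=
  measurableSet_lt (by fun_prop) ((measurable_measure_prodMk_right hA).comp measurable_snd)

lemma volume_steiner [SFinite (volume : Measure W)] {A : Set (ℝ × W)} (hA : MeasurableSet A) :
    volume (steiner A) = volume A := by
  rw [Measure.volume_eq_prod, Measure.prod_apply_symm (measurableSet_steiner hA),
    Measure.prod_apply_symm hA]
  simp_rw [steiner_section, volume_centeredInterval]

lemma lintegral_lintegral_prod_prod [SFinite (volume : Measure W)]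
    {F : ℝ × W → ℝ × W → ℝ≥0∞} (hF : Measurable (Function.uncurry F)) :
    ∫⁻ p, ∫⁻ q, F p q = ∫⁻ w, ∫⁻ w', ∫⁻ t, ∫⁻ t', F (t, w) (t', w') := by
  have hF' : ∀ p, Measurable (F p) := fun p => hF.comp measurable_prodMk_left
  rw [Measure.volume_eq_prod, lintegral_prod_symm' (fun p => ∫⁻ q, F p q ∂volume.prod volume)
    (Measurable.lintegral_prod_right' (f := Function.uncurry F) hF)]
  refine lintegral_congr fun w => ?_
  simp_rw [lintegral_prod_symm' _ (hF' _)]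
  refine lintegral_lintegral_swap (Measurable.aemeasurable ?_)
  refine Measurable.lintegral_prod_right' (f := fun x : (ℝ × W) × ℝ => F (x.1.1, w) (x.2, x.1.2)) ?_
  exact hF.comp (by fun_prop : Measurable fun x : (ℝ × W) × ℝ => ((x.1.1, w), (x.2, x.1.2)))

lemma rieszForm_prod [Sub W] [MeasurableSub₂ W] [SFinite (volume : Measure W)]
    {X Y Z : Set (ℝ × W)}
    (hX : MeasurableSet X) (hY : MeasurableSet Y) (hZ : MeasurableSet Z) :
    rieszForm X Y Z = ∫⁻ w, ∫⁻ w', rieszForm ((fun t : ℝ => (t, w)) ⁻¹' X)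
      ((fun t : ℝ => (t, w')) ⁻¹' Y) ((fun t : ℝ => (t, w - w')) ⁻¹' Z) := by
  have : MeasurableSub₂ (ℝ × W) :=
    ⟨((measurable_fst.comp measurable_fst).sub (measurable_fst.comp measurable_snd)).prodMk
      ((measurable_snd.comp measurable_fst).sub (measurable_snd.comp measurable_snd))⟩
  have hS := measurableSet_rieszForm hX hY hZ
  rw [rieszForm, ← lintegral_indicator_one hS,
    lintegral_prod _ (measurable_one.indicator hS).aemeasurable,
    lintegral_lintegral_prod_prod (F := fun p q => indicator _ 1 (p, q))
      (measurable_one.indicator hS)]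
  refine lintegral_congr fun w => lintegral_congr fun w' => ?_
  have hS' := measurableSet_rieszForm (measurable_prodMk_right (y := w) hX)
    (measurable_prodMk_right (y := w') hY) (measurable_prodMk_right (y := w - w') hZ)
  rw [rieszForm, ← lintegral_indicator_one hS',
    lintegral_prod _ (measurable_one.indicator hS').aemeasurable]
  rfl

lemma rieszForm_le_steiner [Sub W] [MeasurableSub₂ W] [SFinite (volume : Measure W)]
    {X Y Z : Set (ℝ × W)}
    (hX : MeasurableSet X) (hY : MeasurableSet Y) (hZ : MeasurableSet Z)
    (hX' : ∀ w, volume ((fun t : ℝ => (t, w)) ⁻¹' X) ≠ ∞)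
    (hY' : ∀ w, volume ((fun t : ℝ => (t, w)) ⁻¹' Y) ≠ ∞)
    (hZ' : ∀ w, volume ((fun t : ℝ => (t, w)) ⁻¹' Z) ≠ ∞) :
    rieszForm X Y Z ≤ rieszForm (steiner X) (steiner Y) (steiner Z) := by
  rw [rieszForm_prod hX hY hZ, rieszForm_prod (measurableSet_steiner hX)
    (measurableSet_steiner hY) (measurableSet_steiner hZ)]
  refine lintegral_mono fun w => lintegral_mono fun w' => ?_
  exact rieszForm_le_centeredInterval (measurable_prodMk_right hZ) (measurable_prodMk_right hY)
    (measurable_prodMk_right hX) (hZ' _) (hY' _) (hX' _)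

lemma volume_centeredInterval_diff_add_le {S : Set ℝ} (hS : MeasurableSet S)
    {δ : ℝ≥0∞} (hδ : δ ≠ ∞) (τ : ℝ) :
    volume (centeredInterval (volume S) \ centeredInterval δ) +
      volume {t | t ∈ S \ centeredInterval δ ∧ t + τ ∈ centeredInterval δ \ S} ≤
      volume (S \ centeredInterval δ) := by
  have hI := measurableSet_centeredInterval δ
  have hK1 : volume {t | t ∈ S \ centeredInterval δ ∧ t + τ ∈ centeredInterval δ \ S} ≤
      volume (S \ centeredInterval δ) := measure_mono fun t h => h.1
  have hK2 : volume {t | t ∈ S \ centeredInterval δ ∧ t + τ ∈ centeredInterval δ \ S} ≤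
      volume (centeredInterval δ \ S) := by
    rw [← measure_preimage_add_right volume τ (centeredInterval δ \ S)]
    exact measure_mono fun t h => h.2
  rcases le_total (volume S) δ with h | h
  · rw [sdiff_eq_empty.2 (centeredInterval_mono h), measure_empty, zero_add]
    exact hK1
  · have h1 : volume (centeredInterval (volume S) \ centeredInterval δ) = volume S - δ := by
      rw [measure_sdiff (centeredInterval_mono h) hI.nullMeasurableSet
        (by rwa [volume_centeredInterval]), volume_centeredInterval, volume_centeredInterval]
    rw [h1, ← ENNReal.add_le_add_iff_left hδ, ← add_assoc, add_tsub_cancel_of_le h]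
    refine (add_le_add le_rfl hK2).trans (le_of_eq ?_)
    have e1 := measure_add_sdiff (μ := volume) hS.nullMeasurableSet (centeredInterval δ)
    have e2 := measure_add_sdiff (μ := volume) hI.nullMeasurableSet S
    rw [volume_centeredInterval] at e2
    rw [e1, e2, union_comm]

lemma volume_steiner_diff_add_le [AddMonoid W] [MeasurableAdd₂ W] [SFinite (volume : Measure W)]
    {A D : Set (ℝ × W)} (hA : MeasurableSet A) (hDm : MeasurableSet D)
    (hD : ∀ w, ∃ δ ≠ ∞, (fun t : ℝ => (t, w)) ⁻¹' D = centeredInterval δ) (τ : ℝ) :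
    volume (steiner A \ D) + volume {p | p ∈ A \ D ∧ p + (τ, 0) ∈ D \ A} ≤ volume (A \ D) := by
  have hm1 := (measurableSet_steiner hA).diff hDm
  have hm2 : MeasurableSet {p | p ∈ A \ D ∧ p + (τ, 0) ∈ D \ A} :=
    (hA.diff hDm).inter ((by fun_prop : Measurable fun p : ℝ × W => (p.1 + τ, p.2 + 0))
      (hDm.diff hA))
  rw [Measure.volume_eq_prod, Measure.prod_apply_symm hm1, Measure.prod_apply_symm hm2,
    Measure.prod_apply_symm (hA.diff hDm),
    ← lintegral_add_left (measurable_measure_prodMk_right hm1)]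
  refine lintegral_mono fun w => ?_
  obtain ⟨δ, hδ, h⟩ := hD w
  have := volume_centeredInterval_diff_add_le (measurable_prodMk_right (y := w) hA) hδ τ
  rw [← h] at this
  have e : (fun t : ℝ => (t, w)) ⁻¹' {p | p ∈ A \ D ∧ p + (τ, 0) ∈ D \ A} =
      {t | t ∈ (fun t : ℝ => (t, w)) ⁻¹' A \ (fun t : ℝ => (t, w)) ⁻¹' D ∧
        t + τ ∈ (fun t : ℝ => (t, w)) ⁻¹' D \ (fun t : ℝ => (t, w)) ⁻¹' A} := by
    ext t
    simp
  rw [e]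
  exact this

end Steiner

lemma exists_coordinates {m : ℕ} (v : EuclideanSpace ℝ (Fin (m + 1))) :
    ∃ φ : EuclideanSpace ℝ (Fin (m + 1)) ≃ᵐ ℝ × (Fin m → ℝ), MeasurePreserving φ ∧
      (∀ x y, φ (x - y) = φ x - φ y) ∧ (∃ τ : ℝ, ∀ x, φ (x + v) = φ x + (τ, 0)) ∧
      ∀ x, ‖x‖ ^ 2 = (φ x).1 ^ 2 + ∑ i, (φ x).2 i ^ 2 := by
  let w : EuclideanSpace ℝ (Fin (m + 1)) := EuclideanSpace.single 0 ‖v‖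
  have hvw : ‖v‖ = ‖w‖ := by simp [w]
  let Q := (ℝ ∙ (v - w))ᗮ.reflection
  have hQ : Q v = w := Submodule.reflection_sub hvw
  let φ := (Q.toMeasurableEquiv.trans (MeasurableEquiv.toLp 2 (Fin (m + 1) → ℝ)).symm).trans
    (MeasurableEquiv.piFinSuccAbove (fun _ => ℝ) 0)
  have hφ : ∀ x, φ x = (Q x 0, fun i => Q x i.succ) := fun x => rfl
  refine ⟨φ, ?_, fun x y => ?_, ⟨‖v‖, fun x => ?_⟩, fun x => ?_⟩
  · exact (volume_preserving_piFinSuccAbove (fun _ => ℝ) 0).comp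
      ((PiLp.volume_preserving_ofLp (Fin (m + 1))).comp Q.measurePreserving)
  · rw [hφ, hφ, hφ, map_sub]
    rfl
  · rw [hφ, hφ, map_add, hQ]
    ext i <;> simp [w]
  · rw [hφ, ← Q.norm_map x, EuclideanSpace.norm_sq_eq, Fin.sum_univ_succ]
    simp

lemma exists_symmetrization {m : ℕ} (v : EuclideanSpace ℝ (Fin (m + 1))) :
    ∃ S : Set (EuclideanSpace ℝ (Fin (m + 1))) → Set (EuclideanSpace ℝ (Fin (m + 1))),
      (∀ A, MeasurableSet A → MeasurableSet (S A) ∧ volume (S A) = volume A) ∧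
      (∀ A R, A ⊆ Metric.ball 0 R → S A ⊆ Metric.ball 0 R) ∧
      (∀ A ρ, MeasurableSet A → volume (S A \ Metric.ball 0 ρ) +
        volume {x | x ∈ A \ Metric.ball 0 ρ ∧ x + v ∈ Metric.ball 0 ρ \ A} ≤
          volume (A \ Metric.ball 0 ρ)) ∧
      (∀ X Y Z R, MeasurableSet X → MeasurableSet Y → MeasurableSet Z → X ⊆ Metric.ball 0 R →
        Y ⊆ Metric.ball 0 R → Z ⊆ Metric.ball 0 R →
        rieszForm X Y Z ≤ rieszForm (S X) (S Y) (S Z)) := by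
  obtain ⟨φ, hφ, hsub, ⟨τ, hτ⟩, hnorm⟩ := exists_coordinates v
  have hφs : MeasurePreserving φ.symm := hφ.symm φ
  have hvol : ∀ A, volume (φ ⁻¹' A) = volume A := fun A => hφ.measure_preimage_equiv A
  have hvols : ∀ A, volume (φ.symm ⁻¹' A) = volume A := fun A => hφs.measure_preimage_equiv A
  have hsect : ∀ ρ w, ∃ δ ≠ ∞, (fun t : ℝ => (t, w)) ⁻¹' (φ.symm ⁻¹' Metric.ball 0 ρ) =
      centeredInterval δ := by
    intro ρ w
    have key : ∀ t : ℝ, (t, w) ∈ φ.symm ⁻¹' Metric.ball 0 ρ ↔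
        0 < ρ ∧ t ^ 2 < ρ ^ 2 - ∑ i, w i ^ 2 := by
      intro t
      rw [mem_preimage, mem_ball_zero_iff]
      have := hnorm (φ.symm (t, w))
      rw [φ.apply_symm_apply] at this
      constructor
      · intro h
        have h0 := norm_nonneg (φ.symm (t, w))
        refine ⟨by linarith, ?_⟩
        simp only at this
        nlinarith
      · rintro ⟨h0, h⟩
        refine lt_of_pow_lt_pow_left₀ 2 h0.le ?_
        simp only at this
        linarith
    by_cases h : 0 < ρ ∧ 0 < ρ ^ 2 - ∑ i, w i ^ 2
    · refine ⟨ENNReal.ofReal (2 * √(ρ ^ 2 - ∑ i, w i ^ 2)), ENNReal.ofReal_ne_top, ?_⟩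
      ext t
      have h2 : 0 < √(ρ ^ 2 - ∑ i, w i ^ 2) := Real.sqrt_pos.2 h.2
      rw [mem_preimage, key, centeredInterval, mem_ofPred_eq,
        ENNReal.ofReal_lt_ofReal_iff (by positivity), ← sq_abs t, ← Real.lt_sqrt (abs_nonneg t)]
      constructor
      · rintro ⟨-, h⟩; linarith
      · intro h'; exact ⟨h.1, by linarith⟩
    · refine ⟨0, ENNReal.zero_ne_top, ?_⟩
      ext t
      rw [mem_preimage, key]
      simp only [centeredInterval, mem_ofPred_eq, not_lt_zero, iff_false]
      rintro ⟨h1, h2⟩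
      exact h ⟨h1, (sq_nonneg t).trans_lt h2⟩
  have hfin : ∀ {A : Set (EuclideanSpace ℝ (Fin (m + 1)))} {R}, A ⊆ Metric.ball 0 R →
      ∀ w, volume ((fun t : ℝ => (t, w)) ⁻¹' (φ.symm ⁻¹' A)) ≠ ∞ := by
    intro A R hA w
    obtain ⟨δ, hδ, h⟩ := hsect R w
    refine ne_top_of_le_ne_top hδ ?_
    rw [← volume_centeredInterval δ, ← h]
    exact measure_mono (preimage_mono (preimage_mono hA))
  have hriesz : ∀ {X Y Z : Set (EuclideanSpace ℝ (Fin (m + 1)))},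
      MeasurableSet X → MeasurableSet Y → MeasurableSet Z →
      ∀ X' Y' Z', φ ⁻¹' X' = X → φ ⁻¹' Y' = Y → φ ⁻¹' Z' = Z →
      rieszForm X Y Z = rieszForm X' Y' Z' := by
    intro X Y Z hX hY hZ X' Y' Z' eX eY eZ
    rw [rieszForm, rieszForm, ← (hφ.prod hφ).measure_preimage_emb
      (φ.prodCongr φ).measurableEmbedding]
    congr 1
    ext p
    rw [← eX, ← eY, ← eZ]
    simp only [mem_preimage, mem_ofPred_eq, hsub, Prod.map_fst, Prod.map_snd]
  have hpre : ∀ A : Set (EuclideanSpace ℝ (Fin (m + 1))), φ ⁻¹' (φ.symm ⁻¹' A) = A := by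
    intro A
    ext x
    simp
  refine ⟨fun A => φ ⁻¹' steiner (φ.symm ⁻¹' A), fun A hA => ⟨?_, ?_⟩, fun A R hA => ?_,
    fun A ρ hA => ?_, fun X Y Z R hX hY hZ hXR hYR hZR => ?_⟩
  · exact φ.measurable (measurableSet_steiner (φ.symm.measurable hA))
  · rw [hvol, volume_steiner (φ.symm.measurable hA), hvols]
  · rw [← hpre (Metric.ball 0 R)]
    refine preimage_mono (steiner_subset (preimage_mono hA) fun w => ?_)
    obtain ⟨δ, -, h⟩ := hsect R w
    exact ⟨δ, h⟩
  · have h := volume_steiner_diff_add_le (φ.symm.measurable hA)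
      (φ.symm.measurable (measurableSet_ball (x := (0 : EuclideanSpace ℝ (Fin (m + 1)))) (ε := ρ)))
      (hsect ρ) τ
    rw [← hvol, ← hvol {p | _}, ← hvol (_ \ _)] at h
    convert h using 3
    · rw [preimage_sdiff, hpre]
    · ext x
      simp [← hτ]
    · rw [preimage_sdiff, hpre, hpre]
  · have hm := fun {A : Set (EuclideanSpace ℝ (Fin (m + 1)))} (hA : MeasurableSet A) =>
      φ.symm.measurable hA
    have hms := fun {A : Set (EuclideanSpace ℝ (Fin (m + 1)))} (hA : MeasurableSet A) =>
      φ.measurable (measurableSet_steiner (hm hA))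
    rw [hriesz hX hY hZ _ _ _ (hpre X) (hpre Y) (hpre Z),
      hriesz (hms hX) (hms hY) (hms hZ) _ _ _ rfl rfl rfl]
    exact rieszForm_le_steiner (hm hX) (hm hY) (hm hZ) (hfin hXR) (hfin hYR) (hfin hZR)

lemma exists_volume_ball_eq {m : ℕ} {a : ℝ≥0∞} (ha : a ≠ ∞) :
    ∃ ρ : ℝ, volume (Metric.ball (0 : EuclideanSpace ℝ (Fin (m + 1))) ρ) = a := by
  set V := volume (Metric.ball (0 : EuclideanSpace ℝ (Fin (m + 1))) 1) with hV
  have hV0 : V ≠ 0 := (Metric.measure_ball_pos _ _ one_pos).ne'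
  have hV1 : V ≠ ∞ := measure_ball_lt_top.ne
  have hq : a / V ≠ ∞ := ENNReal.div_ne_top ha hV0
  refine ⟨(a / V).toReal ^ ((m + 1 : ℕ) : ℝ)⁻¹, ?_⟩
  rw [Measure.addHaar_ball _ _ (Real.rpow_nonneg ENNReal.toReal_nonneg _),
    finrank_euclideanSpace_fin,
    Real.rpow_inv_natCast_pow ENNReal.toReal_nonneg (Nat.succ_ne_zero m), ENNReal.ofReal_toReal hq]
  exact ENNReal.div_mul_cancel hV0 hV1

lemma exists_volume_inter_translate_ge {m : ℕ} {F G : Set (EuclideanSpace ℝ (Fin (m + 1)))}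
    (hF : MeasurableSet F) (hG : MeasurableSet G) {R : ℝ} (hR : 0 < R)
    (hFR : F ⊆ Metric.ball 0 R) (hGR : G ⊆ Metric.ball 0 R) :
    ∃ v, volume F * volume G / volume (Metric.ball (0 : EuclideanSpace ℝ (Fin (m + 1))) (2 * R)) ≤
      volume {x | x ∈ F ∧ x + v ∈ G} := by
  set D := Metric.ball (0 : EuclideanSpace ℝ (Fin (m + 1))) (2 * R) with hD
  have hF1 : volume F ≠ ∞ := ne_top_of_le_ne_top measure_ball_lt_top.ne (measure_mono hFR)
  have hG1 : volume G ≠ ∞ := ne_top_of_le_ne_top measure_ball_lt_top.ne (measure_mono hGR)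
  have hmeas : MeasurableSet {p : EuclideanSpace ℝ (Fin (m + 1)) × EuclideanSpace ℝ (Fin (m + 1)) |
      p.2 ∈ F ∧ p.2 + p.1 ∈ G} :=
    (measurable_snd hF).inter ((measurable_snd.add measurable_fst) hG)
  have htot : ∫⁻ v in D, volume {x | x ∈ F ∧ x + v ∈ G} = volume F * volume G := by
    rw [← lintegral_indicator measurableSet_ball]
    have h1 : (fun v => D.indicator (fun v => volume {x | x ∈ F ∧ x + v ∈ G}) v) =
        fun v => volume {x | x ∈ F ∧ x + v ∈ G} := by
      ext v
      by_cases hv : v ∈ D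
      · rw [indicator_of_mem hv]
      · rw [indicator_of_notMem hv]
        symm
        convert measure_empty (μ := (volume : Measure (EuclideanSpace ℝ (Fin (m + 1)))))
        ext x
        simp only [mem_ofPred_eq, mem_empty_iff_false, iff_false, not_and]
        intro hx hxv
        apply hv
        have h1 := hFR hx
        have h2 := hGR hxv
        rw [mem_ball_zero_iff] at h1 h2 ⊢
        calc ‖v‖ = ‖(x + v) - x‖ := by rw [add_sub_cancel_left]
          _ ≤ ‖x + v‖ + ‖x‖ := norm_sub_le _ _
          _ < 2 * R := by linarith
    rw [h1]
    refine (Measure.prod_apply (ν := volume) hmeas).symm.trans ?_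
    rw [Measure.prod_apply_symm hmeas, mul_comm, ← setLIntegral_const, ← lintegral_indicator hF]
    refine lintegral_congr fun x => ?_
    by_cases hx : x ∈ F
    · rw [indicator_of_mem hx, ← measure_preimage_add volume x G]
      congr 1
      ext v
      simp [hx]
    · rw [indicator_of_notMem hx]
      simp [hx]
  obtain ⟨v, -, hv⟩ := exists_setLAverage_le (μ := volume) (s := D)
    (f := fun v => volume {x | x ∈ F ∧ x + v ∈ G})
    (Metric.measure_ball_pos _ _ (by positivity)).ne' measurableSet_ball.nullMeasurableSet
    (by rw [htot]; exact ENNReal.mul_ne_top hF1 hG1)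
  refine ⟨v, ?_⟩
  rwa [setLAverage_eq, htot] at hv

lemma rieszForm_le_add_sdiff {m : ℕ} {X Y Z D₀ D₁ D₂ : Set (EuclideanSpace ℝ (Fin (m + 1)))}
    (hZ : MeasurableSet Z) (h₁ : MeasurableSet D₁) (h₂ : MeasurableSet D₂) :
    rieszForm X Y Z ≤ rieszForm D₀ D₁ D₂ + (volume (X \ D₀) * volume Y +
      volume D₀ * volume (Y \ D₁) + volume (Z \ D₂) * volume D₁) := by
  have e0 : rieszForm X Y Z ≤ rieszForm D₀ Y Z + rieszForm (X \ D₀) Y Z := by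
    refine (measure_mono ?_).trans (measure_union_le _ _)
    rintro p ⟨h0, h1, h2⟩
    by_cases h : p.1 ∈ D₀
    · exact Or.inl ⟨h, h1, h2⟩
    · exact Or.inr ⟨⟨h0, h⟩, h1, h2⟩
  have e1 : rieszForm D₀ Y Z ≤ rieszForm D₀ D₁ Z + rieszForm D₀ (Y \ D₁) Z := by
    refine (measure_mono ?_).trans (measure_union_le _ _)
    rintro p ⟨h0, h1, h2⟩
    by_cases h : p.2 ∈ D₁
    · exact Or.inl ⟨h0, h, h2⟩
    · exact Or.inr ⟨h0, ⟨h1, h⟩, h2⟩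
  have e2 : rieszForm D₀ D₁ Z ≤ rieszForm D₀ D₁ D₂ + rieszForm D₀ D₁ (Z \ D₂) := by
    refine (measure_mono ?_).trans (measure_union_le _ _)
    rintro p ⟨h0, h1, h2⟩
    by_cases h : p.1 - p.2 ∈ D₂
    · exact Or.inl ⟨h0, h1, h⟩
    · exact Or.inr ⟨h0, h1, h2, h⟩
  calc rieszForm X Y Z ≤ rieszForm D₀ D₁ D₂ + rieszForm D₀ D₁ (Z \ D₂) +
        rieszForm D₀ (Y \ D₁) Z + rieszForm (X \ D₀) Y Z :=
        e0.trans (by gcongr; exact e1.trans (by gcongr))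
    _ ≤ rieszForm D₀ D₁ D₂ + volume (Z \ D₂) * volume D₁ +
        volume D₀ * volume (Y \ D₁) + volume (X \ D₀) * volume Y := by
        gcongr
        · exact rieszForm_le_mul' h₁ (hZ.diff h₂)
        · exact rieszForm_le_mul
        · exact rieszForm_le_mul
    _ = _ := by ring

/-- The total volume by which three sets differ from the centred balls of radii `ρ`. -/
noncomputable def ballDefect {m : ℕ} (ρ : Fin 3 → ℝ)
    (X : Fin 3 → Set (EuclideanSpace ℝ (Fin (m + 1)))) : ℝ≥0∞ :=
  ∑ i, volume (X i \ Metric.ball 0 (ρ i))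

lemma exists_ballDefect_add_le {m : ℕ} {X : Fin 3 → Set (EuclideanSpace ℝ (Fin (m + 1)))}
    (hX : ∀ i, MeasurableSet (X i)) {R : ℝ} (hR : 0 < R) (hXR : ∀ i, X i ⊆ Metric.ball 0 R)
    {ρ : Fin 3 → ℝ} (hρR : ∀ i, Metric.ball (0 : EuclideanSpace ℝ (Fin (m + 1))) (ρ i) ⊆
      Metric.ball 0 R)
    (hρ : ∀ i, volume (Metric.ball (0 : EuclideanSpace ℝ (Fin (m + 1))) (ρ i)) = volume (X i)) :
    ∃ X' : Fin 3 → Set (EuclideanSpace ℝ (Fin (m + 1))), (∀ i, MeasurableSet (X' i)) ∧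
      (∀ i, X' i ⊆ Metric.ball 0 R) ∧ (∀ i, volume (X' i) = volume (X i)) ∧
      rieszForm (X 0) (X 1) (X 2) ≤ rieszForm (X' 0) (X' 1) (X' 2) ∧
      ballDefect ρ X' + (ballDefect ρ X / 3) ^ 2 /
        volume (Metric.ball (0 : EuclideanSpace ℝ (Fin (m + 1))) (2 * R)) ≤ ballDefect ρ X := by
  obtain ⟨i, hi⟩ : ∃ i, ballDefect ρ X / 3 ≤ volume (X i \ Metric.ball 0 (ρ i)) := by
    by_contra! h
    have h3 : ballDefect ρ X < ∑ _i : Fin 3, ballDefect ρ X / 3 :=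
      ENNReal.sum_lt_sum_of_nonempty ⟨0, Finset.mem_univ 0⟩ fun i _ => h i
    rw [Finset.sum_const, Finset.card_univ, Fintype.card_fin, nsmul_eq_mul] at h3
    rw [Nat.cast_ofNat, ENNReal.mul_div_cancel (by simp) (by simp)] at h3
    exact lt_irrefl _ h3
  have hfin : ∀ i, volume (X i) ≠ ∞ := fun i =>
    ne_top_of_le_ne_top measure_ball_lt_top.ne (measure_mono (hXR i))
  have hFG : volume (Metric.ball 0 (ρ i) \ X i) = volume (X i \ Metric.ball 0 (ρ i)) := by
    have h1 := measure_sdiff_add_inter (μ := volume) (Metric.ball 0 (ρ i)) (hX i)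
    have h2 := measure_sdiff_add_inter (μ := volume) (X i)
      (measurableSet_ball (x := (0 : EuclideanSpace ℝ (Fin (m + 1)))) (ε := ρ i))
    rw [hρ i, ← h2, inter_comm] at h1
    exact (ENNReal.add_left_inj (ne_top_of_le_ne_top (hfin i)
      (measure_mono inter_subset_left))).1 h1
  obtain ⟨v, hv⟩ := exists_volume_inter_translate_ge ((hX i).diff measurableSet_ball)
    (measurableSet_ball.diff (hX i)) hR (sdiff_subset.trans (hXR i)) (sdiff_subset.trans (hρR i))
  obtain ⟨S, hS, hSR, hSρ, hSf⟩ := exists_symmetrization v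
  refine ⟨fun j => S (X j), fun j => (hS _ (hX j)).1, fun j => hSR _ _ (hXR j),
    fun j => (hS _ (hX j)).2, hSf _ _ _ R (hX 0) (hX 1) (hX 2) (hXR 0) (hXR 1) (hXR 2), ?_⟩
  have hle : ∀ j, volume (S (X j) \ Metric.ball 0 (ρ j)) ≤ volume (X j \ Metric.ball 0 (ρ j)) :=
    fun j => le_self_add.trans (hSρ (X j) (ρ j) (hX j))
  rw [hFG] at hv
  have hq : (ballDefect ρ X / 3) ^ 2 /
        volume (Metric.ball (0 : EuclideanSpace ℝ (Fin (m + 1))) (2 * R)) ≤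
      volume {x | x ∈ X i \ Metric.ball 0 (ρ i) ∧ x + v ∈ Metric.ball 0 (ρ i) \ X i} := by
    refine le_trans ?_ hv
    rw [sq]
    gcongr
  simp only [ballDefect] at hq ⊢
  rw [← Finset.add_sum_erase _ _ (Finset.mem_univ i),
    ← Finset.add_sum_erase Finset.univ (fun j => volume (X j \ Metric.ball 0 (ρ j)))
      (Finset.mem_univ i), add_right_comm]
  rw [← Finset.add_sum_erase Finset.univ (fun j => volume (X j \ Metric.ball 0 (ρ j)))
      (Finset.mem_univ i)] at hq
  exact add_le_add ((add_le_add le_rfl hq).trans (hSρ (X i) (ρ i) (hX i)))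
    (Finset.sum_le_sum fun j _ => hle j)

lemma rieszForm_le_ball_of_subset {m : ℕ} {X : Fin 3 → Set (EuclideanSpace ℝ (Fin (m + 1)))}
    (hX : ∀ i, MeasurableSet (X i)) {R : ℝ} (hR : 0 < R) (hXR : ∀ i, X i ⊆ Metric.ball 0 R)
    {ρ : Fin 3 → ℝ} (hρR : ∀ i, Metric.ball (0 : EuclideanSpace ℝ (Fin (m + 1))) (ρ i) ⊆
      Metric.ball 0 R)
    (hρ : ∀ i, volume (Metric.ball (0 : EuclideanSpace ℝ (Fin (m + 1))) (ρ i)) = volume (X i)) :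
    rieszForm (X 0) (X 1) (X 2) ≤ rieszForm
      (Metric.ball (0 : EuclideanSpace ℝ (Fin (m + 1))) (ρ 0)) (Metric.ball 0 (ρ 1))
      (Metric.ball 0 (ρ 2)) := by
  have hfin : ∀ i, volume (X i) ≠ ∞ := fun i =>
    ne_top_of_le_ne_top measure_ball_lt_top.ne (measure_mono (hXR i))
  let 𝒮 : Set (Fin 3 → Set (EuclideanSpace ℝ (Fin (m + 1)))) := {X' | (∀ i, MeasurableSet (X' i)) ∧
      (∀ i, X' i ⊆ Metric.ball 0 R) ∧ (∀ i, volume (X' i) = volume (X i)) ∧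
      rieszForm (X 0) (X 1) (X 2) ≤ rieszForm (X' 0) (X' 1) (X' 2)}
  let ι := ⨅ X' ∈ 𝒮, ballDefect ρ X'
  have hX𝒮 : X ∈ 𝒮 := ⟨hX, hXR, fun _ => rfl, le_rfl⟩
  have hι1 : ι ≠ ∞ := by
    refine ne_top_of_le_ne_top ?_ (iInf₂_le X hX𝒮)
    exact ENNReal.sum_ne_top.2 fun i _ => ne_top_of_le_ne_top (hfin i) (measure_mono sdiff_subset)
  have hι0 : ι = 0 := by
    have h : ι + (ι / 3) ^ 2 /
        volume (Metric.ball (0 : EuclideanSpace ℝ (Fin (m + 1))) (2 * R)) ≤ ι := by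
      refine le_iInf₂ fun X' hX' => ?_
      obtain ⟨X'', h1, h2, h3, h4, h5⟩ := exists_ballDefect_add_le hX'.1 hR hX'.2.1 hρR
        (fun i => (hρ i).trans (hX'.2.2.1 i).symm)
      refine le_trans ?_ h5
      gcongr
      · exact iInf₂_le X'' ⟨h1, h2, fun i => (h3 i).trans (hX'.2.2.1 i), hX'.2.2.2.trans h4⟩
      · exact iInf₂_le X' hX'
    have h2 : (ι / 3) ^ 2 /
        volume (Metric.ball (0 : EuclideanSpace ℝ (Fin (m + 1))) (2 * R)) ≤ 0 :=
      (ENNReal.add_le_add_iff_left hι1).1 (by simpa using h)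
    have h3 := (ENNReal.div_eq_zero_iff.1 (le_zero_iff.1 h2)).resolve_right measure_ball_lt_top.ne
    have h4 := (ENNReal.div_eq_zero_iff.1 ((pow_eq_zero_iff two_ne_zero).1 h3))
    exact h4.resolve_right (by simp)
  set T := rieszForm (Metric.ball (0 : EuclideanSpace ℝ (Fin (m + 1))) (ρ 0))
    (Metric.ball 0 (ρ 1)) (Metric.ball 0 (ρ 2)) with hT
  let K := 2 * volume (X 1) + volume (X 0)
  have hK : K ≠ ∞ := by simp [K, hfin, ENNReal.mul_eq_top]
  have hle : ∀ X' ∈ 𝒮, rieszForm (X 0) (X 1) (X 2) - T ≤ ballDefect ρ X' * K := by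
    intro X' hX'
    rw [tsub_le_iff_left]
    refine (hX'.2.2.2.trans (rieszForm_le_add_sdiff (D₀ := Metric.ball 0 (ρ 0)) (hX'.1 2)
      (measurableSet_ball (x := 0) (ε := ρ 1)) (measurableSet_ball (x := 0) (ε := ρ 2)))).trans ?_
    rw [hX'.2.2.1, hρ, hρ]
    have hi : ∀ i, volume (X' i \ Metric.ball 0 (ρ i)) ≤ ballDefect ρ X' := fun i =>
      Finset.single_le_sum (f := fun i => volume (X' i \ Metric.ball 0 (ρ i)))
        (fun _ _ => zero_le) (Finset.mem_univ i)
    calc _ ≤ T + (ballDefect ρ X' * volume (X 1) + volume (X 0) * ballDefect ρ X' +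
          ballDefect ρ X' * volume (X 1)) := by
          gcongr
          · exact hi 0
          · exact hi 1
          · exact hi 2
      _ = _ := by simp only [K]; ring
  have h0 : rieszForm (X 0) (X 1) (X 2) - T ≤ 0 := by
    by_contra! h
    have : (rieszForm (X 0) (X 1) (X 2) - T) / K ≤ ι :=
      le_iInf₂ fun X' hX' => ENNReal.div_le_of_le_mul (hle X' hX')
    rw [hι0, le_zero_iff, ENNReal.div_eq_zero_iff] at this
    exact this.elim h.ne' hK
  exact tsub_eq_zero_iff_le.1 (le_zero_iff.1 h0)

/-- The Riesz rearrangement inequality for sets of finite volume. -/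
lemma rieszForm_le_ball {m : ℕ} {X : Fin 3 → Set (EuclideanSpace ℝ (Fin (m + 1)))}
    (hX : ∀ i, MeasurableSet (X i)) {ρ : Fin 3 → ℝ}
    (hρ : ∀ i, volume (Metric.ball (0 : EuclideanSpace ℝ (Fin (m + 1))) (ρ i)) = volume (X i)) :
    rieszForm (X 0) (X 1) (X 2) ≤ rieszForm
      (Metric.ball (0 : EuclideanSpace ℝ (Fin (m + 1))) (ρ 0)) (Metric.ball 0 (ρ 1))
      (Metric.ball 0 (ρ 2)) := by
  let Y : ℕ → Fin 3 → Set (EuclideanSpace ℝ (Fin (m + 1))) := fun k i => X i ∩ Metric.ball 0 k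
  have hlim : rieszForm (X 0) (X 1) (X 2) = ⨆ k, rieszForm (Y k 0) (Y k 1) (Y k 2) := by
    simp only [rieszForm]
    rw [← Monotone.measure_iUnion]
    · congr 1
      ext p
      simp only [mem_iUnion]
      constructor
      · rintro ⟨h0, h1, h2⟩
        obtain ⟨k, hk⟩ := exists_nat_gt (max (max ‖p.1‖ ‖p.2‖) ‖p.1 - p.2‖)
        simp only [max_lt_iff] at hk
        exact ⟨k, ⟨h0, mem_ball_zero_iff.2 hk.1.1⟩, ⟨h1, mem_ball_zero_iff.2 hk.1.2⟩,
          ⟨h2, mem_ball_zero_iff.2 hk.2⟩⟩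
      · rintro ⟨k, h0, h1, h2⟩
        exact ⟨h0.1, h1.1, h2.1⟩
    · intro k l hkl p hp
      have hb : Metric.ball (0 : EuclideanSpace ℝ (Fin (m + 1))) k ⊆ Metric.ball 0 l :=
        Metric.ball_subset_ball (by exact_mod_cast hkl)
      exact ⟨⟨hp.1.1, hb hp.1.2⟩, ⟨hp.2.1.1, hb hp.2.1.2⟩, ⟨hp.2.2.1, hb hp.2.2.2⟩⟩
  rw [hlim]
  refine iSup_le fun k => ?_
  have hY : ∀ i, ∃ σ, σ ≤ ρ i ∧
      volume (Metric.ball (0 : EuclideanSpace ℝ (Fin (m + 1))) σ) = volume (Y k i) := by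
    intro i
    obtain ⟨σ, hσ⟩ := exists_volume_ball_eq (m := m) (a := volume (Y k i))
      (ne_top_of_le_ne_top measure_ball_lt_top.ne (measure_mono inter_subset_right))
    rcases le_total σ (ρ i) with h | h
    · exact ⟨σ, h, hσ⟩
    · refine ⟨ρ i, le_rfl, le_antisymm ?_ ?_⟩
      · rw [← hσ]
        exact measure_mono (Metric.ball_subset_ball h)
      · rw [hρ]
        exact measure_mono inter_subset_left
  choose σ hσρ hσ using hY
  let R : ℝ := max (max k 1) (max (max (σ 0) (σ 1)) (σ 2))
  have hkR : (k : ℝ) ≤ R := (le_max_left _ _).trans (le_max_left _ _)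
  refine (rieszForm_le_ball_of_subset (X := Y k) (fun i => (hX i).inter measurableSet_ball)
    (R := R) ?_ ?_ (ρ := σ) ?_ hσ).trans ?_
  · exact one_pos.trans_le ((le_max_right _ _).trans (le_max_left _ _))
  · exact fun i => inter_subset_right.trans (Metric.ball_subset_ball hkR)
  · intro i
    refine Metric.ball_subset_ball ?_
    fin_cases i <;> simp [R]
  · exact rieszForm_mono (Metric.ball_subset_ball (hσρ 0)) (Metric.ball_subset_ball (hσρ 1))
      (Metric.ball_subset_ball (hσρ 2))

lemma lintegral_ite_ofReal_lt {a : ℝ≥0∞} (ha : a ≤ 1) (b : ℝ≥0∞) :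
    ∫⁻ θ in Ioo (0 : ℝ) 1, (if ENNReal.ofReal θ < a then 1 else b) = a + (1 - a) * b := by
  lift a to NNReal using ne_top_of_le_ne_top ENNReal.one_ne_top ha
  have ha' : (a : ℝ) ≤ 1 := by exact_mod_cast ha
  have hs : MeasurableSet {θ : ℝ | ENNReal.ofReal θ < a} :=
    measurableSet_lt (by fun_prop) measurable_const
  have h1 : volume ({θ : ℝ | ENNReal.ofReal θ < a} ∩ Ioo 0 1) = a := by
    have : {θ : ℝ | ENNReal.ofReal θ < a} ∩ Ioo 0 1 = Ioo 0 (a : ℝ) := by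
      ext θ
      simp only [mem_inter_iff, mem_ofPred_eq, mem_Ioo]
      constructor
      · rintro ⟨h, h0, -⟩
        refine ⟨h0, ?_⟩
        rwa [← ENNReal.ofReal_coe_nnreal, ENNReal.ofReal_lt_ofReal_iff_of_nonneg h0.le] at h
      · rintro ⟨h0, h⟩
        refine ⟨?_, h0, h.trans_le ha'⟩
        rwa [← ENNReal.ofReal_coe_nnreal, ENNReal.ofReal_lt_ofReal_iff_of_nonneg h0.le]
    rw [this, Real.volume_Ioo, sub_zero, ENNReal.ofReal_coe_nnreal]
  have h2 : volume ({θ : ℝ | ENNReal.ofReal θ < a}ᶜ ∩ Ioo 0 1) = 1 - a := by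
    have := measure_inter_add_sdiff (μ := volume) (Ioo (0 : ℝ) 1) hs
    rw [inter_comm, h1, Real.volume_Ioo, sub_zero, ENNReal.ofReal_one] at this
    rw [inter_comm, ← Set.sdiff_eq, ← this, ENNReal.add_sub_cancel_left ENNReal.coe_ne_top]
  have h3 : (fun θ : ℝ => if ENNReal.ofReal θ < a then 1 else b) =
      fun θ => {θ : ℝ | ENNReal.ofReal θ < a}.indicator (fun _ => 1) θ +
        {θ : ℝ | ENNReal.ofReal θ < a}ᶜ.indicator (fun _ => b) θ := by
    ext θ
    by_cases h : ENNReal.ofReal θ < a <;> simp [h]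
  rw [h3, lintegral_add_left (measurable_const.indicator hs), lintegral_indicator_const hs,
    lintegral_indicator_const hs.compl, Measure.restrict_apply hs, Measure.restrict_apply hs.compl,
    h1, h2, one_mul, mul_comm]

section Layers

variable {α : Type*} [MeasurableSpace α] {μ : Measure α} [SFinite μ]

lemma setLIntegral_add_one_sub_mul {f F : α → ℝ≥0∞} (hf : Measurable f) (hF : Measurable F)
    (hf1 : ∀ x, f x ≤ 1) (S : Set α) :
    ∫⁻ x in S, (f x + (1 - f x) * F x) ∂μ = ∫⁻ θ in Ioo (0 : ℝ) 1,
      (μ ({x | ENNReal.ofReal θ < f x} ∩ S) +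
        ∫⁻ x in S \ {x | ENNReal.ofReal θ < f x}, F x ∂μ) := by
  have hm : MeasurableSet {p : α × ℝ | ENNReal.ofReal p.2 < f p.1} :=
    measurableSet_lt (by fun_prop) (by fun_prop)
  simp_rw [← fun x => lintegral_ite_ofReal_lt (hf1 x) (F x)]
  rw [lintegral_lintegral_swap]
  · refine lintegral_congr fun θ => ?_
    have hθ : MeasurableSet {x | ENNReal.ofReal θ < f x} := measurableSet_lt measurable_const hf
    have h3 : (fun x => if ENNReal.ofReal θ < f x then 1 else F x) =
      fun x => {x | ENNReal.ofReal θ < f x}.indicator (fun _ => 1) x +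
        {x | ENNReal.ofReal θ < f x}ᶜ.indicator F x := by
      ext x
      by_cases h : ENNReal.ofReal θ < f x <;> simp [h]
    rw [h3, lintegral_add_left (measurable_const.indicator hθ), lintegral_indicator_const hθ,
      lintegral_indicator hθ.compl, Measure.restrict_apply hθ, one_mul,
      Measure.restrict_restrict hθ.compl, Set.sdiff_eq, inter_comm S]
  · exact (Measurable.ite hm measurable_const (by fun_prop)).aemeasurable

lemma setLIntegral_eq_layers {f : α → ℝ≥0∞} (hf : Measurable f)
    (hf1 : ∀ x, f x ≤ 1) (S : Set α) :
    ∫⁻ x in S, f x ∂μ =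
      ∫⁻ θ in Ioo (0 : ℝ) 1, μ ({x | ENNReal.ofReal θ < f x} ∩ S) := by
  have := setLIntegral_add_one_sub_mul (μ := μ) hf (measurable_const (a := 0)) hf1 S
  simpa using this

end Layers

lemma measure_lt_ne_top_of_lintegral_ne_top {α : Type*} [MeasurableSpace α] {μ : Measure α}
    {f : α → ℝ≥0∞} (hf : Measurable f)
    (h : ∫⁻ x, f x ∂μ ≠ ∞) {t : ℝ≥0∞} (ht : t ≠ 0) : μ {x | t < f x} ≠ ∞ := by
  intro h1
  have h2 := mul_meas_ge_le_lintegral (μ := μ) hf t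
  have h3 : μ {x | t ≤ f x} = ∞ := measure_mono_top (by rintro x (hx : t < f x); exact hx.le) h1
  rw [h3, ENNReal.mul_top ht] at h2
  exact h (top_le_iff.1 h2)

lemma continuous_volume_union_inter_ball {m : ℕ} {L M : Set (EuclideanSpace ℝ (Fin (m + 1)))}
    (hL1 : volume L ≠ ∞) :
    Continuous fun r : ℝ => volume (L ∪ (M ∩ Metric.ball 0 r)) := by
  let b : ℝ → ℝ := fun r => (volume (Metric.ball (0 : EuclideanSpace ℝ (Fin (m + 1))) r)).toReal
  have hb : Continuous b := by
    have : b = fun r => (max r 0) ^ (m + 1) *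
        (volume (Metric.ball (0 : EuclideanSpace ℝ (Fin (m + 1))) 1)).toReal := by
      ext r
      rcases le_total r 0 with h | h
      · simp [b, Metric.ball_eq_empty.2 h, max_eq_right h]
      · simp only [b]
        rw [Measure.addHaar_ball _ _ h, finrank_euclideanSpace_fin, max_eq_left h,
          ENNReal.toReal_mul, ENNReal.toReal_ofReal (by positivity)]
    rw [this]
    fun_prop
  have hfin : ∀ r, volume (L ∪ (M ∩ Metric.ball 0 r)) ≠ ∞ := fun r =>
    measure_union_ne_top hL1 (ne_top_of_le_ne_top measure_ball_lt_top.ne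
      (measure_mono inter_subset_right))
  let φ : ℝ → ℝ := fun r => (volume (L ∪ (M ∩ Metric.ball 0 r))).toReal
  have key : ∀ r s, r ≤ s → φ r ≤ φ s ∧ φ s ≤ φ r + (b s - b r) := by
    intro r s hrs
    have hball := Metric.ball_subset_ball (x := (0 : EuclideanSpace ℝ (Fin (m + 1)))) hrs
    have hbs : volume (Metric.ball (0 : EuclideanSpace ℝ (Fin (m + 1))) s) ≠ ∞ :=
      measure_ball_lt_top.ne
    have hbr : volume (Metric.ball (0 : EuclideanSpace ℝ (Fin (m + 1))) r) ≠ ∞ :=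
      measure_ball_lt_top.ne
    refine ⟨ENNReal.toReal_mono (hfin s) (measure_mono (by gcongr)), ?_⟩
    have h := (measure_mono (μ := volume) (s := L ∪ (M ∩ Metric.ball 0 s))
      (t := (L ∪ (M ∩ Metric.ball 0 r)) ∪ (Metric.ball 0 s \ Metric.ball 0 r)) (by
        rintro x (h | ⟨h, h'⟩)
        · exact Or.inl (Or.inl h)
        · by_cases hx : x ∈ Metric.ball 0 r
          · exact Or.inl (Or.inr ⟨h, hx⟩)
          · exact Or.inr ⟨h', hx⟩)).trans (measure_union_le _ _)
    rw [measure_sdiff hball measurableSet_ball.nullMeasurableSet hbr] at h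
    have h' := ENNReal.toReal_mono (by simp [hfin, hbs]) h
    rw [ENNReal.toReal_add (hfin r) (by simp [hbs]),
      ENNReal.toReal_sub_of_le (measure_mono hball) hbs] at h'
    exact h'
  have hφ : Continuous φ := by
    refine continuous_iff_continuousAt.2 fun r => ?_
    refine tendsto_iff_dist_tendsto_zero.2 (squeeze_zero (fun _ => dist_nonneg) (fun s => ?_)
      (tendsto_iff_dist_tendsto_zero.1 (hb.tendsto r)))
    rw [Real.dist_eq, Real.dist_eq]
    rcases le_total r s with h | h
    · have := key r s h
      rw [abs_of_nonneg (by linarith)]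
      exact le_trans (by linarith) (le_abs_self _)
    · have := key s r h
      rw [abs_sub_comm, abs_sub_comm (b s), abs_of_nonneg (by linarith)]
      exact le_trans (by linarith) (le_abs_self _)
  have : (fun r : ℝ => volume (L ∪ (M ∩ Metric.ball 0 r))) = fun r => ENNReal.ofReal (φ r) := by
    ext r
    exact (ENNReal.ofReal_toReal (hfin r)).symm
  rw [this]
  exact ENNReal.continuous_ofReal.comp hφ

lemma exists_measurableSet_volume_eq_between {m : ℕ} {L M : Set (EuclideanSpace ℝ (Fin (m + 1)))}
    (hL : MeasurableSet L) (hM : MeasurableSet M) (hLM : L ⊆ M) {γ : ℝ≥0∞} (hγ : γ ≠ ∞)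
    (h1 : volume L ≤ γ) (h2 : γ ≤ volume M) :
    ∃ H, MeasurableSet H ∧ L ⊆ H ∧ H ⊆ M ∧ volume H = γ := by
  rcases h2.eq_or_lt with h2 | h2
  · exact ⟨M, hM, hLM, Subset.rfl, h2.symm⟩
  have hlim : volume M = ⨆ k : ℕ, volume (L ∪ (M ∩ Metric.ball 0 k)) := by
    rw [← Monotone.measure_iUnion]
    · congr 1
      refine Subset.antisymm (fun x hx => ?_)
        (iUnion_subset fun k => union_subset hLM inter_subset_left)
      obtain ⟨k, hk⟩ := exists_nat_gt ‖x‖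
      exact mem_iUnion.2 ⟨k, Or.inr ⟨hx, mem_ball_zero_iff.2 hk⟩⟩
    · intro k l hkl
      have : (k : ℝ) ≤ l := by exact_mod_cast hkl
      exact union_subset_union_right _ (inter_subset_inter_right _ (Metric.ball_subset_ball this))
  rw [hlim] at h2
  obtain ⟨k, hk⟩ := lt_iSup_iff.1 h2
  obtain ⟨r, hr⟩ := mem_range_of_exists_le_of_exists_ge
    (continuous_volume_union_inter_ball (M := M) (ne_top_of_le_ne_top hγ h1))
    ⟨0, by simpa using h1⟩ ⟨(k : ℝ), hk.le⟩
  exact ⟨_, hL.union (hM.inter measurableSet_ball), subset_union_left,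
    union_subset hLM inter_subset_left, hr⟩

lemma exists_nested_volume_eq {m : ℕ} {f : EuclideanSpace ℝ (Fin (m + 1)) → ℝ≥0∞}
    (hf : Measurable f) (hf1 : ∀ x, f x ≤ 1) (hfi : ∫⁻ x, f x ≠ ∞)
    {C : Set (EuclideanSpace ℝ (Fin (m + 1)))} (hC : MeasurableSet C) {γ : ℝ≥0∞} (hγ : γ ≠ ∞)
    (hCγ : volume C ≤ γ) :
    ∃ H, MeasurableSet H ∧ C ⊆ H ∧ volume H = γ ∧
      ∀ t, C ∪ {x | t < f x} ⊆ H ∨ H ⊆ C ∪ {x | t < f x} := by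
  let U : ℝ≥0∞ → Set (EuclideanSpace ℝ (Fin (m + 1))) := fun t => C ∪ {x | t < f x}
  have hU : ∀ t, MeasurableSet (U t) := fun t => hC.union (measurableSet_lt measurable_const hf)
  have hUanti : Antitone U := fun s t hst =>
    union_subset_union_right _ (by rintro x hx; exact hst.trans_lt hx)
  let t₀ := sInf {t | volume (U t) ≤ γ}
  have ht₀1 : t₀ ≤ 1 := by
    refine sInf_le ?_
    have : U 1 = C := by
      refine union_eq_left.2 ?_
      rintro x hx
      exact absurd (hf1 x) (not_le.2 hx)
    change volume (U 1) ≤ γ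
    rwa [this]
  have hgt : ∀ t, t₀ < t → volume (U t) ≤ γ := by
    intro t ht
    obtain ⟨s, hs, hst⟩ := sInf_lt_iff.1 ht
    exact (measure_mono (hUanti hst.le)).trans hs
  have hlt : ∀ t, t < t₀ → γ < volume (U t) := by
    intro t ht
    by_contra! h
    exact absurd (sInf_le (a := t) h) (not_le.2 ht)
  let M : Set (EuclideanSpace ℝ (Fin (m + 1))) := C ∪ {x | t₀ ≤ f x}
  have hM : MeasurableSet M := hC.union (measurableSet_le measurable_const hf)
  have hLM : U t₀ ⊆ M := union_subset_union_right _ (by rintro x (hx : t₀ < f x); exact hx.le)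
  have hL : volume (U t₀) ≤ γ := by
    obtain ⟨u, hu, hu1, hu2⟩ := exists_seq_strictAnti_tendsto' (ht₀1.trans_lt ENNReal.one_lt_top)
    have : U t₀ = ⋃ n, U (u n) := by
      refine Subset.antisymm ?_ (iUnion_subset fun n => hUanti (hu1 n).1.le)
      rintro x (hx | hx)
      · exact mem_iUnion.2 ⟨0, Or.inl hx⟩
      · obtain ⟨n, hn⟩ := (hu2.eventually_lt_const hx).exists
        exact mem_iUnion.2 ⟨n, Or.inr hn⟩
    rw [this, Monotone.measure_iUnion fun k l hkl => hUanti (hu.antitone hkl)]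
    exact iSup_le fun n => hgt _ (hu1 n).1
  have hMγ : γ ≤ volume M := by
    rcases eq_or_ne t₀ 0 with h0 | h0
    · obtain ⟨ρ, hρ⟩ := exists_volume_ball_eq (m := m) hγ
      rw [← hρ]
      refine measure_mono ?_
      rintro x -
      exact Or.inr (h0.trans_le zero_le)
    · obtain ⟨u, hu, hu1, hu2⟩ := exists_seq_strictMono_tendsto' (pos_iff_ne_zero.2 h0)
      have : M = ⋂ n, U (u n) := by
        refine Subset.antisymm (subset_iInter fun n => ?_) ?_
        · exact union_subset_union_right _ (by rintro x hx; exact (hu1 n).2.trans_le hx)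
        · intro x hx
          rw [mem_iInter] at hx
          by_cases hxC : x ∈ C
          · exact Or.inl hxC
          · exact Or.inr (le_of_tendsto' hu2 fun n => ((hx n).resolve_left hxC).le)
      rw [this, Antitone.measure_iInter (fun k l hkl => hUanti (hu.monotone hkl))
        (fun n => (hU _).nullMeasurableSet)]
      · exact le_iInf fun n => (hlt _ (hu1 n).2).le
      · exact ⟨0, measure_union_ne_top (ne_top_of_le_ne_top hγ hCγ)
          (measure_lt_ne_top_of_lintegral_ne_top hf hfi (hu1 0).1.ne')⟩
  obtain ⟨H, hH, h1, h2, h3⟩ := exists_measurableSet_volume_eq_between (hU t₀) hM hLM hγ hL hMγ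
  refine ⟨H, hH, subset_union_left.trans h1, h3, fun t => ?_⟩
  rcases lt_or_ge t t₀ with h | h
  · refine Or.inr (h2.trans (union_subset_union_right _ ?_))
    rintro x hx
    exact h.trans_le hx
  · exact Or.inl ((hUanti h).trans h1)

/-- Sets that are unions of centred spheres, with no gaps: balls, or the whole space. -/
def IsCentred {m : ℕ} (S : Set (EuclideanSpace ℝ (Fin (m + 1)))) : Prop :=
  ∀ ⦃x y⦄, ‖x‖ ≤ ‖y‖ → y ∈ S → x ∈ S

section Centred

variable {m : ℕ} {S T : Set (EuclideanSpace ℝ (Fin (m + 1)))}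

lemma isCentred_ball (r : ℝ) : IsCentred (Metric.ball (0 : EuclideanSpace ℝ (Fin (m + 1))) r) :=
  fun _ _ h hy => mem_ball_zero_iff.2 (h.trans_lt (mem_ball_zero_iff.1 hy))

lemma IsCentred.subset_or_subset (hS : IsCentred S) (hT : IsCentred T) : S ⊆ T ∨ T ⊆ S := by
  by_contra! h
  obtain ⟨x, hxS, hxT⟩ := not_subset.1 h.1
  obtain ⟨y, hyT, hyS⟩ := not_subset.1 h.2
  rcases le_total ‖x‖ ‖y‖ with h | h
  · exact hxT (hT h hyT)
  · exact hyS (hS h hxS)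

lemma IsCentred.volume_sdiff (hS : IsCentred S) (hT : IsCentred T) (hTm : MeasurableSet T)
    (hT1 : volume T ≠ ∞) : volume (S \ T) = volume S - volume T := by
  rcases hS.subset_or_subset hT with h | h
  · rw [sdiff_eq_empty.2 h, measure_empty, tsub_eq_zero_of_le (measure_mono h)]
  · exact measure_sdiff h hTm.nullMeasurableSet hT1

lemma IsCentred.volume_union (hS : IsCentred S) (hT : IsCentred T) :
    volume (S ∪ T) = max (volume S) (volume T) := by
  rcases hS.subset_or_subset hT with h | h
  · rw [union_eq_right.2 h, max_eq_right (measure_mono h)]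
  · rw [union_eq_left.2 h, max_eq_left (measure_mono h)]

lemma IsCentred.union (hS : IsCentred S) (hT : IsCentred T) : IsCentred (S ∪ T) := by
  rintro x y h (hy | hy)
  · exact Or.inl (hS h hy)
  · exact Or.inr (hT h hy)

end Centred

lemma isCentred_setOf_lt {m : ℕ} {g : EuclideanSpace ℝ (Fin (m + 1)) → ℝ≥0∞}
    (hg : ∀ ⦃x y⦄, ‖x‖ ≤ ‖y‖ → g y ≤ g x) (t : ℝ≥0∞) : IsCentred {x | t < g x} :=
  fun _ _ h hy => lt_of_lt_of_le hy (hg h)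

lemma setLIntegral_compl_eq_lintegral_tsub {m : ℕ} {g : EuclideanSpace ℝ (Fin (m + 1)) → ℝ≥0∞}
    (hgm : Measurable g) (hg1 : ∀ x, g x ≤ 1) (hg : ∀ ⦃x y⦄, ‖x‖ ≤ ‖y‖ → g y ≤ g x)
    {D : Set (EuclideanSpace ℝ (Fin (m + 1)))} (hD : IsCentred D) (hDm : MeasurableSet D)
    (hD1 : volume D ≠ ∞) :
    ∫⁻ x in Dᶜ, g x =
      ∫⁻ η in Ioo (0 : ℝ) 1, (volume {x | ENNReal.ofReal η < g x} - volume D) := by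
  rw [setLIntegral_eq_layers hgm hg1]
  refine lintegral_congr fun η => ?_
  rw [← Set.sdiff_eq, (isCentred_setOf_lt hg _).volume_sdiff hD hDm hD1]

lemma antitone_setOf_ofReal_lt {α : Type*} (f : α → ℝ≥0∞) :
    Antitone fun θ : ℝ => {x | ENNReal.ofReal θ < f x} := fun _ _ h x hx =>
  (ENNReal.ofReal_le_ofReal h).trans_lt (show _ < f x from hx)

lemma measurable_volume_setOf_lt {m : ℕ} (g : EuclideanSpace ℝ (Fin (m + 1)) → ℝ≥0∞) :
    Measurable fun η : ℝ => volume {x | ENNReal.ofReal η < g x} := by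
  have : Antitone fun η : ℝ => volume {x | ENNReal.ofReal η < g x} := fun _ _ h =>
    measure_mono (antitone_setOf_ofReal_lt g h)
  exact this.measurable

/-- `f` is less concentrated than the radially decreasing function `g`: outside every set `C` of
finite volume, `f` has at least the mass that `g` has outside the centred ball of the same volume.
-/
structure LessConcentrated {m : ℕ} (f g : EuclideanSpace ℝ (Fin (m + 1)) → ℝ≥0∞) : Prop where
  measurable_left : Measurable f
  measurable_right : Measurable g
  left_le_one : ∀ x, f x ≤ 1
  right_le_one : ∀ x, g x ≤ 1
  left_ne_top : ∫⁻ x, f x ≠ ∞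
  right_ne_top : ∫⁻ x, g x ≠ ∞
  radial : ∀ ⦃x y⦄, ‖x‖ ≤ ‖y‖ → g y ≤ g x
  lintegral_le : ∀ C, MeasurableSet C → volume C ≠ ∞ →
    ∫⁻ η in Ioo (0 : ℝ) 1, (volume {x | ENNReal.ofReal η < g x} - volume C) ≤ ∫⁻ x in Cᶜ, f x

lemma lintegral_Ioo_zero_one_const_add {F : ℝ → ℝ≥0∞} (c : ℝ≥0∞) :
    ∫⁻ θ in Ioo (0 : ℝ) 1, (c + F θ) = c + ∫⁻ θ in Ioo (0 : ℝ) 1, F θ := by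
  rw [lintegral_add_left measurable_const, setLIntegral_const, Real.volume_Ioo, sub_zero,
    ENNReal.ofReal_one, mul_one]

lemma LessConcentrated.tsub_add_lintegral_le {m : ℕ}
    {f g : EuclideanSpace ℝ (Fin (m + 1)) → ℝ≥0∞} (h : LessConcentrated f g)
    {C : Set (EuclideanSpace ℝ (Fin (m + 1)))} (hC : MeasurableSet C) (hC1 : volume C ≠ ∞)
    {γ : ℝ≥0∞} (hγ : γ ≠ ∞) :
    (γ - volume C) + ∫⁻ ζ in Ioo (0 : ℝ) 1,
        (volume {x | ENNReal.ofReal ζ < g x} - max γ (volume C)) ≤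
      ∫⁻ θ in Ioo (0 : ℝ) 1, (volume ({x | ENNReal.ofReal θ < f x} ∩ Cᶜ) +
        (γ - volume (C ∪ {x | ENNReal.ofReal θ < f x}))) := by
  rcases le_total γ (volume C) with hγC | hγC
  · rw [tsub_eq_zero_of_le hγC, zero_add, max_eq_right hγC]
    refine (h.lintegral_le C hC hC1).trans ?_
    rw [setLIntegral_eq_layers h.measurable_left h.left_le_one]
    exact lintegral_mono fun θ => le_self_add
  · obtain ⟨H, hH, hCH, hHγ, hnest⟩ := exists_nested_volume_eq h.measurable_left h.left_le_one
      h.left_ne_top hC hγ hγC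
    rw [max_eq_left hγC]
    have h1 := h.lintegral_le H hH (by rwa [hHγ])
    rw [hHγ] at h1
    refine (add_le_add le_rfl h1).trans ?_
    rw [setLIntegral_eq_layers h.measurable_left h.left_le_one, ← lintegral_Ioo_zero_one_const_add]
    refine lintegral_mono fun θ => ?_
    set V := {x | ENNReal.ofReal θ < f x} with hV
    have hVm : MeasurableSet V := measurableSet_lt measurable_const h.measurable_left
    rcases hnest (ENNReal.ofReal θ) with hn | hn
    · have hVH : V ∩ Hᶜ = ∅ := by
        rw [← Set.sdiff_eq, sdiff_eq_empty]
        exact subset_union_right.trans hn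
      have hU : volume (C ∪ V) = volume C + volume (V ∩ Cᶜ) := by
        rw [← Set.sdiff_eq, ← measure_union disjoint_sdiff_right (hVm.diff hC), union_sdiff_self]
      rw [hVH, measure_empty, add_zero, hU, tsub_le_iff_left]
      calc γ ≤ (volume C + volume (V ∩ Cᶜ)) + (γ - (volume C + volume (V ∩ Cᶜ))) :=
            le_add_tsub
        _ = _ := add_assoc _ _ _
    · have hHV : H \ C ⊆ V := by
        rintro x ⟨hx, hxC⟩
        exact (hn hx).resolve_left hxC
      refine le_add_right ?_
      rw [← hHγ, ← measure_sdiff hCH hC.nullMeasurableSet hC1, ← measure_union]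
      · refine measure_mono ?_
        rintro x (hx | hx)
        · exact ⟨hHV hx, hx.2⟩
        · exact ⟨hx.1, fun hxC => hx.2 (hCH hxC)⟩
      · rw [Set.disjoint_left]
        rintro x hx hx'
        exact hx'.2 hx.1
      · exact hVm.inter hH.compl

lemma ENNReal.one_sub_mul_one_sub {a b : ℝ≥0∞} (ha : a ≤ 1) (hb : b ≤ 1) :
    1 - (1 - a) * (1 - b) = a + (1 - a) * b := by
  symm
  refine ENNReal.eq_sub_of_add_eq ?_ ?_
  · exact ENNReal.mul_ne_top (by simp) (by simp)
  · rw [add_assoc, ← mul_add, add_tsub_cancel_of_le hb, mul_one, add_tsub_cancel_of_le ha]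

lemma LessConcentrated.one_sub_mul {m : ℕ} {f₁ f₂ g₁ g₂ : EuclideanSpace ℝ (Fin (m + 1)) → ℝ≥0∞}
    (h₁ : LessConcentrated f₁ g₁) (h₂ : LessConcentrated f₂ g₂) :
    LessConcentrated (fun x => 1 - (1 - f₁ x) * (1 - f₂ x))
      (fun x => 1 - (1 - g₁ x) * (1 - g₂ x)) := by
  have hf₁ := h₁.measurable_left
  have hf₂ := h₂.measurable_left
  have hg₁ := h₁.measurable_right
  have hg₂ := h₂.measurable_right
  have hint : ∀ {u v : EuclideanSpace ℝ (Fin (m + 1)) → ℝ≥0∞}, Measurable u → (∀ x, u x ≤ 1) →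
      (∀ x, v x ≤ 1) → ∫⁻ x, u x ≠ ∞ → ∫⁻ x, v x ≠ ∞ →
      ∫⁻ x, (1 - (1 - u x) * (1 - v x)) ≠ ∞ := by
    intro u v hum hu hv hui hvi
    refine ne_top_of_le_ne_top (ENNReal.add_ne_top.2 ⟨hui, hvi⟩) ?_
    rw [← lintegral_add_left hum]
    refine lintegral_mono fun x => ?_
    rw [ENNReal.one_sub_mul_one_sub (hu x) (hv x)]
    gcongr
    exact mul_le_of_le_one_left' tsub_le_self
  have hgm : Measurable fun x => 1 - (1 - g₁ x) * (1 - g₂ x) := by fun_prop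
  have hrad : ∀ ⦃x y⦄, ‖x‖ ≤ ‖y‖ →
      1 - (1 - g₁ y) * (1 - g₂ y) ≤ 1 - (1 - g₁ x) * (1 - g₂ x) := fun x y hxy =>
    tsub_le_tsub_left (mul_le_mul' (tsub_le_tsub_left (h₁.radial hxy) _)
      (tsub_le_tsub_left (h₂.radial hxy) _)) _
  refine ⟨by fun_prop, hgm, fun _ => tsub_le_self, fun _ => tsub_le_self,
    hint hf₁ h₁.left_le_one h₂.left_le_one h₁.left_ne_top h₂.left_ne_top,
    hint hg₁ h₁.right_le_one h₂.right_le_one h₁.right_ne_top h₂.right_ne_top, hrad, ?_⟩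
  intro C hC hC1
  obtain ⟨ρ, hρ⟩ := exists_volume_ball_eq (m := m) hC1
  set D := Metric.ball (0 : EuclideanSpace ℝ (Fin (m + 1))) ρ with hD
  have hDm : MeasurableSet D := measurableSet_ball
  have hDc : IsCentred D := isCentred_ball ρ
  have hD1 : volume D ≠ ∞ := by rwa [hρ]
  have hlt : ∀ {u : EuclideanSpace ℝ (Fin (m + 1)) → ℝ≥0∞}, Measurable u → ∀ t,
      MeasurableSet {x | t < u x} := fun hu t => measurableSet_lt measurable_const hu
  let γ : ℝ → ℝ≥0∞ := fun η => volume {x | ENNReal.ofReal η < g₂ x}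
  let U : ℝ → Set (EuclideanSpace ℝ (Fin (m + 1))) := fun θ => C ∪ {x | ENNReal.ofReal θ < f₁ x}
  have hγm : Measurable γ := measurable_volume_setOf_lt g₂
  have hUm : Measurable fun θ => volume (U θ) := by
    have : Antitone fun θ => volume (U θ) := fun _ _ h =>
      measure_mono (union_subset_union_right _ (antitone_setOf_ofReal_lt f₁ h))
    exact this.measurable
  have hVm : Measurable fun θ => volume ({x | ENNReal.ofReal θ < f₁ x} ∩ Cᶜ) := by
    have : Antitone fun θ => volume ({x | ENNReal.ofReal θ < f₁ x} ∩ Cᶜ) := fun _ _ h =>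
      measure_mono (inter_subset_inter_left _ (antitone_setOf_ofReal_lt f₁ h))
    exact this.measurable
  calc ∫⁻ η in Ioo (0 : ℝ) 1,
        (volume {x | ENNReal.ofReal η < 1 - (1 - g₁ x) * (1 - g₂ x)} - volume C)
      = ∫⁻ x in Dᶜ, (1 - (1 - g₁ x) * (1 - g₂ x)) := by
        rw [← hρ]
        exact (setLIntegral_compl_eq_lintegral_tsub hgm (fun _ => tsub_le_self) hrad hDc hDm
          hD1).symm
    _ = ∫⁻ x in Dᶜ, (g₂ x + (1 - g₂ x) * g₁ x) := by
        refine lintegral_congr fun x => ?_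
        rw [mul_comm, ENNReal.one_sub_mul_one_sub (h₂.right_le_one x) (h₁.right_le_one x)]
    _ = ∫⁻ η in Ioo (0 : ℝ) 1, ((γ η - volume C) + ∫⁻ ζ in Ioo (0 : ℝ) 1,
          (volume {x | ENNReal.ofReal ζ < g₁ x} - max (γ η) (volume C))) := by
        rw [setLIntegral_add_one_sub_mul hg₂ hg₁ h₂.right_le_one]
        refine setLIntegral_congr_fun measurableSet_Ioo fun η hη => ?_
        have hG := isCentred_setOf_lt h₂.radial (ENNReal.ofReal η)
        have hG1 : volume {x | ENNReal.ofReal η < g₂ x} ≠ ∞ :=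
          measure_lt_ne_top_of_lintegral_ne_top hg₂ h₂.right_ne_top
            (ENNReal.ofReal_pos.2 hη.1).ne'
        have e : Dᶜ \ {x | ENNReal.ofReal η < g₂ x} = ({x | ENNReal.ofReal η < g₂ x} ∪ D)ᶜ := by
          rw [compl_union, Set.sdiff_eq, inter_comm]
        rw [← Set.sdiff_eq, hG.volume_sdiff hDc hDm hD1, e,
          setLIntegral_compl_eq_lintegral_tsub hg₁ h₁.right_le_one h₁.radial (hG.union hDc)
            ((hlt hg₂ _).union hDm) (measure_union_ne_top hG1 hD1), hG.volume_union hDc, hρ]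
    _ ≤ ∫⁻ η in Ioo (0 : ℝ) 1, ∫⁻ θ in Ioo (0 : ℝ) 1,
          (volume ({x | ENNReal.ofReal θ < f₁ x} ∩ Cᶜ) + (γ η - volume (U θ))) := by
        refine setLIntegral_mono' measurableSet_Ioo fun η hη => ?_
        exact h₁.tsub_add_lintegral_le hC hC1 (measure_lt_ne_top_of_lintegral_ne_top hg₂
          h₂.right_ne_top (ENNReal.ofReal_pos.2 hη.1).ne')
    _ = ∫⁻ θ in Ioo (0 : ℝ) 1, (volume ({x | ENNReal.ofReal θ < f₁ x} ∩ Cᶜ) +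
          ∫⁻ η in Ioo (0 : ℝ) 1, (γ η - volume (U θ))) := by
        rw [lintegral_lintegral_swap]
        · exact lintegral_congr fun θ => lintegral_Ioo_zero_one_const_add _
        · exact ((hVm.comp measurable_snd).add
            ((hγm.comp measurable_fst).sub (hUm.comp measurable_snd))).aemeasurable
    _ ≤ ∫⁻ θ in Ioo (0 : ℝ) 1, (volume ({x | ENNReal.ofReal θ < f₁ x} ∩ Cᶜ) +
          ∫⁻ x in Cᶜ \ {x | ENNReal.ofReal θ < f₁ x}, f₂ x) := by
        refine setLIntegral_mono' measurableSet_Ioo fun θ hθ => add_le_add le_rfl ?_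
        have hU1 : volume (U θ) ≠ ∞ := measure_union_ne_top hC1
          (measure_lt_ne_top_of_lintegral_ne_top hf₁ h₁.left_ne_top
            (ENNReal.ofReal_pos.2 hθ.1).ne')
        have e : Cᶜ \ {x | ENNReal.ofReal θ < f₁ x} = (U θ)ᶜ := by
          rw [compl_union, Set.sdiff_eq]
        rw [e]
        exact h₂.lintegral_le (U θ) (hC.union (hlt hf₁ _)) hU1
    _ = ∫⁻ x in Cᶜ, (f₁ x + (1 - f₁ x) * f₂ x) :=
        (setLIntegral_add_one_sub_mul hf₁ hf₂ h₁.left_le_one _).symm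
    _ = ∫⁻ x in Cᶜ, (1 - (1 - f₁ x) * (1 - f₂ x)) := by
        refine lintegral_congr fun x => ?_
        rw [ENNReal.one_sub_mul_one_sub (h₁.left_le_one x) (h₂.left_le_one x)]

lemma lessConcentrated_zero {m : ℕ} :
    LessConcentrated (fun _ : EuclideanSpace ℝ (Fin (m + 1)) => 0) fun _ => 0 :=
  ⟨measurable_const, measurable_const, by simp, by simp, by simp, by simp, by simp, by simp⟩

lemma LessConcentrated.one_sub_prod {m : ℕ} {ι : Type*} (s : Finset ι)
    {f g : ι → EuclideanSpace ℝ (Fin (m + 1)) → ℝ≥0∞} (h : ∀ i, LessConcentrated (f i) (g i)) :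
    LessConcentrated (fun x => 1 - ∏ i ∈ s, (1 - f i x)) (fun x => 1 - ∏ i ∈ s, (1 - g i x)) := by
  classical
  induction s using Finset.induction_on with
  | empty => simpa using lessConcentrated_zero
  | insert a s ha ih =>
    have hle : ∀ u : ι → EuclideanSpace ℝ (Fin (m + 1)) → ℝ≥0∞, ∀ x,
        1 - (1 - ∏ i ∈ s, (1 - u i x)) = ∏ i ∈ s, (1 - u i x) := fun u x =>
      ENNReal.sub_sub_cancel ENNReal.one_ne_top (Finset.prod_le_one' fun i _ => tsub_le_self)
    have := (h a).one_sub_mul ih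
    simp only [hle] at this
    simpa only [Finset.prod_insert ha] using this

lemma LessConcentrated.lintegral_le_lintegral {m : ℕ}
    {f g : EuclideanSpace ℝ (Fin (m + 1)) → ℝ≥0∞} (h : LessConcentrated f g) :
    ∫⁻ x, g x ≤ ∫⁻ x, f x := by
  have := h.lintegral_le ∅ .empty (by simp)
  rw [measure_empty, compl_empty, setLIntegral_univ] at this
  rw [← setLIntegral_univ g, setLIntegral_eq_layers h.measurable_right h.right_le_one]
  simpa using this

lemma exists_isometry_swap {E : Type*} [NormedAddCommGroup E] [InnerProductSpace ℝ E]
    {x y : E} (hxy : ‖x‖ ≤ ‖y‖) : ∃ (ℓ : E ≃ₗᵢ[ℝ] E) (c : E), ∀ b,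
      ‖x - (ℓ (b - c) + c)‖ = ‖y - b‖ ∧ ‖y - (ℓ (b - c) + c)‖ = ‖x - b‖ ∧
        (‖y - b‖ ≤ ‖x - b‖ → ‖ℓ (b - c) + c‖ ≤ ‖b‖) := by
  let c : E := (2 : ℝ)⁻¹ • (x + y)
  let ℓ := (ℝ ∙ (y - x))ᗮ.reflection
  have hxc : x - c = -((2 : ℝ)⁻¹ • (y - x)) := by simp only [c]; module
  have hyc : y - c = (2 : ℝ)⁻¹ • (y - x) := by simp only [c]; module
  have hℓ : ℓ (y - x) = -(y - x) := Submodule.reflection_orthogonalComplement_singleton_eq_neg _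
  have hℓx : ℓ (x - c) = y - c := by rw [hxc, hyc, map_neg, map_smul, hℓ, smul_neg, neg_neg]
  have hℓy : ℓ (y - c) = x - c := by rw [hxc, hyc, map_smul, hℓ, smul_neg]
  refine ⟨ℓ, c, fun b => ⟨?_, ?_, fun hb => ?_⟩⟩
  · rw [sub_add_eq_sub_sub_swap, ← hℓy, ← map_sub, ℓ.norm_map, sub_sub_sub_cancel_right]
  · rw [sub_add_eq_sub_sub_swap, ← hℓx, ← map_sub, ℓ.norm_map, sub_sub_sub_cancel_right]
  · set u := y - x with hu
    set k := 2 * (inner ℝ u (b - c) / ‖u‖ ^ 2) with hk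
    have hσ : ℓ (b - c) + c = b - k • u := by
      have : ℓ (b - c) = (b - c) - k • u := by
        simp only [ℓ, k]
        rw [Submodule.reflection_orthogonal_apply, Submodule.reflection_singleton_apply]
        simp only [RCLike.ofReal_real_eq_id, id_eq]
        module
      rw [this]
      abel
    have hku : k * ‖u‖ ^ 2 = 2 * inner ℝ u (b - c) := by
      rcases eq_or_ne u 0 with h | h
      · simp [h]
      · have : ‖u‖ ≠ 0 := norm_ne_zero_iff.2 h
        rw [hk]
        field_simp
    have hbc : 0 ≤ inner ℝ u (b - c) := by
      have h1 : ‖x - b‖ ^ 2 - ‖y - b‖ ^ 2 = 2 * inner ℝ u (b - c) := by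
        simp only [← real_inner_self_eq_norm_sq, hu, c, inner_sub_left, inner_sub_right,
          inner_add_right, inner_smul_right, real_inner_comm b x, real_inner_comm b y,
          real_inner_comm x y]
        ring
      have h2 : ‖y - b‖ ^ 2 ≤ ‖x - b‖ ^ 2 := by gcongr
      linarith
    have hc : 0 ≤ inner ℝ u c := by
      have h1 : ‖y‖ ^ 2 - ‖x‖ ^ 2 = 2 * inner ℝ u c := by
        simp only [← real_inner_self_eq_norm_sq, hu, c, inner_sub_left,
          inner_add_right, inner_smul_right, real_inner_comm x y]
        ring
      have h2 : ‖x‖ ^ 2 ≤ ‖y‖ ^ 2 := by gcongr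
      linarith
    have hk0 : 0 ≤ k := by positivity
    rw [hσ]
    refine le_of_sq_le_sq ?_ (norm_nonneg _)
    rw [norm_sub_sq_real, norm_smul, mul_pow, inner_smul_right, real_inner_comm]
    rw [inner_sub_right] at hku
    have : ‖k‖ ^ 2 * ‖u‖ ^ 2 = k * (2 * (inner ℝ u b - inner ℝ u c)) := by
      rw [← hku, Real.norm_eq_abs, sq_abs]
      ring
    nlinarith [mul_nonneg hk0 hc]

/-- The probability that `x` is covered by `A + b`, where `b` is uniform in `B`. -/
noncomputable def coverProb {E : Type*} [MeasureSpace E] [Sub E] (A B : Set E) (x : E) : ℝ≥0∞ :=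
  volume {b | b ∈ B ∧ x - b ∈ A} / volume B

section CoverProb

variable {m : ℕ} {A B : Set (EuclideanSpace ℝ (Fin (m + 1)))}

lemma measurableSet_inter_sub_mem (hA : MeasurableSet A) (hB : MeasurableSet B)
    (x : EuclideanSpace ℝ (Fin (m + 1))) : MeasurableSet {b | b ∈ B ∧ x - b ∈ A} :=
  hB.inter ((measurable_const.sub measurable_id) hA)

lemma measurable_coverProb (hA : MeasurableSet A) (hB : MeasurableSet B) :
    Measurable (coverProb A B) :=
  (measurable_volume_section hB hA).div_const _

lemma coverProb_le_one (x : EuclideanSpace ℝ (Fin (m + 1))) : coverProb A B x ≤ 1 :=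
  ENNReal.div_le_of_le_mul (by
    rw [one_mul]
    exact measure_mono (by rintro b hb; exact hb.1))

lemma setLIntegral_coverProb (hA : MeasurableSet A) (hB : MeasurableSet B)
    {C : Set (EuclideanSpace ℝ (Fin (m + 1)))} (hC : MeasurableSet C) :
    ∫⁻ x in C, coverProb A B x = rieszForm C B A / volume B := by
  rw [rieszForm_eq_lintegral hC hB hA]
  simp only [coverProb, div_eq_mul_inv]
  rw [lintegral_mul_const _ (measurable_volume_section hB hA)]

lemma lintegral_coverProb (hA : MeasurableSet A) (hB : MeasurableSet B) (hB0 : volume B ≠ 0)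
    (hB1 : volume B ≠ ∞) : ∫⁻ x, coverProb A B x = volume A := by
  rw [← setLIntegral_univ, setLIntegral_coverProb hA hB .univ, rieszForm_univ hB hA,
    ENNReal.mul_div_cancel_right hB0 hB1]

end CoverProb

lemma measure_le_of_diff_subset_preimage {α : Type*} [MeasurableSpace α] {μ : Measure α}
    {σ : α → α} (hσ : MeasurePreserving σ μ μ) {K L : Set α} (hK : MeasurableSet K)
    (hL : MeasurableSet L) (h : K \ L ⊆ σ ⁻¹' (L \ K)) : μ K ≤ μ L := by
  rw [← measure_inter_add_sdiff K hL, ← measure_inter_add_sdiff L hK, inter_comm]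
  exact add_le_add le_rfl ((measure_mono h).trans_eq
    (hσ.measure_preimage (hL.diff hK).nullMeasurableSet))

lemma measurePreserving_isometry_conj_translation {m : ℕ}
    (ℓ : EuclideanSpace ℝ (Fin m) ≃ₗᵢ[ℝ] EuclideanSpace ℝ (Fin m)) (c : EuclideanSpace ℝ (Fin m)) :
    MeasurePreserving (fun b => ℓ (b - c) + c) volume volume :=
  (measurePreserving_add_right volume c).comp
    (ℓ.measurePreserving.comp (measurePreserving_sub_right volume c))

lemma volume_closedBall_inter_closedBall_le {m : ℕ} (r s : ℝ)
    {x y : EuclideanSpace ℝ (Fin (m + 1))} (hxy : ‖x‖ ≤ ‖y‖) :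
    volume {b : EuclideanSpace ℝ (Fin (m + 1)) |
        b ∈ Metric.closedBall 0 s ∧ y - b ∈ Metric.closedBall 0 r} ≤
      volume {b : EuclideanSpace ℝ (Fin (m + 1)) |
        b ∈ Metric.closedBall 0 s ∧ x - b ∈ Metric.closedBall 0 r} := by
  have hK : ∀ z : EuclideanSpace ℝ (Fin (m + 1)), MeasurableSet
      {b | b ∈ Metric.closedBall 0 s ∧ z - b ∈ Metric.closedBall 0 r} := fun z =>
    measurableSet_inter_sub_mem measurableSet_closedBall measurableSet_closedBall z
  obtain ⟨ℓ, c, hℓ⟩ := exists_isometry_swap hxy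
  refine measure_le_of_diff_subset_preimage (measurePreserving_isometry_conj_translation ℓ c)
    (hK y) (hK x) fun b => ?_
  obtain ⟨h1, h2, h3⟩ := hℓ b
  simp only [mem_sdiff, mem_ofPred_eq, mem_preimage, mem_closedBall_zero_iff, not_and, not_le, h1,
    h2]
  rintro ⟨⟨hbs, hby⟩, hbx⟩
  exact ⟨⟨(h3 (hby.trans (hbx hbs).le)).trans hbs, hby⟩, fun _ => hbx hbs⟩

lemma lessConcentrated_coverProb {m : ℕ} {A B : Set (EuclideanSpace ℝ (Fin (m + 1)))}
    (hA : MeasurableSet A) (hB : MeasurableSet B) (hA1 : volume A ≠ ∞) (hB0 : volume B ≠ 0)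
    (hB1 : volume B ≠ ∞) {r s : ℝ}
    (hr : volume (Metric.closedBall (0 : EuclideanSpace ℝ (Fin (m + 1))) r) = volume A)
    (hs : volume (Metric.closedBall (0 : EuclideanSpace ℝ (Fin (m + 1))) s) = volume B) :
    LessConcentrated (coverProb A B)
      (coverProb (Metric.closedBall (0 : EuclideanSpace ℝ (Fin (m + 1))) r)
        (Metric.closedBall 0 s)) := by
  have hAb : MeasurableSet (Metric.closedBall (0 : EuclideanSpace ℝ (Fin (m + 1))) r) :=
    measurableSet_closedBall
  have hBb : MeasurableSet (Metric.closedBall (0 : EuclideanSpace ℝ (Fin (m + 1))) s) :=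
    measurableSet_closedBall
  have hif := lintegral_coverProb hA hB hB0 hB1
  have hig := lintegral_coverProb hAb hBb (by rwa [hs]) (by rwa [hs])
  rw [hr] at hig
  have hgm := measurable_coverProb hAb hBb
  have hrad : ∀ ⦃x y : EuclideanSpace ℝ (Fin (m + 1))⦄, ‖x‖ ≤ ‖y‖ →
      coverProb (Metric.closedBall 0 r) (Metric.closedBall 0 s) y ≤
        coverProb (Metric.closedBall 0 r) (Metric.closedBall 0 s) x := fun x y h =>
    ENNReal.div_le_div_right (volume_closedBall_inter_closedBall_le r s h) _
  refine ⟨measurable_coverProb hA hB, hgm, coverProb_le_one, coverProb_le_one, by rwa [hif],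
    by rwa [hig], hrad, fun C hC hC1 => ?_⟩
  obtain ⟨ρ, hρ⟩ := exists_volume_ball_eq (m := m) hC1
  set D := Metric.ball (0 : EuclideanSpace ℝ (Fin (m + 1))) ρ with hD
  have hDm : MeasurableSet D := measurableSet_ball
  rw [← hρ, ← setLIntegral_compl_eq_lintegral_tsub hgm coverProb_le_one hrad (isCentred_ball ρ) hDm
    (by rwa [hρ])]
  have hCD : ∫⁻ x in C, coverProb A B x ≤
      ∫⁻ x in D, coverProb (Metric.closedBall 0 r) (Metric.closedBall 0 s) x := by
    rw [setLIntegral_coverProb hA hB hC, setLIntegral_coverProb hAb hBb hDm, hs]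
    refine ENNReal.div_le_div_right ?_ _
    refine (rieszForm_le_ball (X := ![C, B, A]) (ρ := ![ρ, s, r]) ?_ ?_).trans
      (rieszForm_mono Subset.rfl Metric.ball_subset_closedBall Metric.ball_subset_closedBall)
    · intro i
      fin_cases i
      exacts [hC, hB, hA]
    · intro i
      fin_cases i
      · exact hρ
      · exact (Measure.addHaar_closedBall_eq_addHaar_ball _ _ _).symm.trans hs
      · exact (Measure.addHaar_closedBall_eq_addHaar_ball _ _ _).symm.trans hr
  have e1 := lintegral_add_compl (μ := volume) (coverProb A B) hC
  have e2 := lintegral_add_compl (μ := volume)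
    (coverProb (Metric.closedBall (0 : EuclideanSpace ℝ (Fin (m + 1))) r)
        (Metric.closedBall 0 s)) hDm
  rw [hif, ← hig, ← e2] at e1
  have hfin : ∫⁻ x in D, coverProb (Metric.closedBall 0 r) (Metric.closedBall 0 s) x ≠ ∞ := by
    refine ne_top_of_le_ne_top hA1 ?_
    rw [← hig]
    exact setLIntegral_le_lintegral _ _
  refine (ENNReal.add_le_add_iff_left hfin).1 ?_
  rw [← e1]
  gcongr

lemma lintegral_volume_iUnion_translates {m n : ℕ}
    {A B : Fin n → Set (EuclideanSpace ℝ (Fin (m + 1)))} (hA : ∀ i, MeasurableSet (A i))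
    (hB0 : ∀ i, volume (B i) ≠ 0) (hB1 : ∀ i, volume (B i) ≠ ∞) :
    ∫⁻ b in univ.pi B, volume (⋃ i, (· + b i) '' (A i)) =
      (∏ i, volume (B i)) * ∫⁻ x, (1 - ∏ i, (1 - coverProb (A i) (B i) x)) := by
  have : ∀ i, IsFiniteMeasure (volume.restrict (B i)) := fun i =>
    ⟨by rw [Measure.restrict_apply_univ]; exact (hB1 i).lt_top⟩
  have hP : ∏ i, volume (B i) ≠ ∞ := ENNReal.prod_ne_top fun i _ => hB1 i
  have hmeas : MeasurableSet {p : (Fin n → EuclideanSpace ℝ (Fin (m + 1))) ×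
      EuclideanSpace ℝ (Fin (m + 1)) | ∃ i, p.2 - p.1 i ∈ A i} := by
    have : {p : (Fin n → EuclideanSpace ℝ (Fin (m + 1))) × EuclideanSpace ℝ (Fin (m + 1)) |
        ∃ i, p.2 - p.1 i ∈ A i} = ⋃ i, (fun p => p.2 - p.1 i) ⁻¹' (A i) := by
      ext p
      simp
    rw [this]
    exact .iUnion fun i => (measurable_snd.sub ((measurable_pi_apply i).comp measurable_fst)) (hA i)
  have hset : ∀ b : Fin n → EuclideanSpace ℝ (Fin (m + 1)), (⋃ i, (· + b i) '' (A i)) =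
      Prod.mk b ⁻¹' {p | ∃ i, p.2 - p.1 i ∈ A i} := by
    intro b
    ext x
    simp [sub_eq_add_neg]
  rw [volume_pi, Measure.restrict_pi_pi]
  simp_rw [hset]
  rw [← Measure.prod_apply hmeas, Measure.prod_apply_symm hmeas, ← lintegral_const_mul' _ _ hP]
  refine lintegral_congr fun x => ?_
  have hAx : ∀ i, MeasurableSet {b : EuclideanSpace ℝ (Fin (m + 1)) | x - b ∈ A i} := fun i =>
    (measurable_const.sub measurable_id) (hA i)
  have hcompl : (fun b : Fin n → EuclideanSpace ℝ (Fin (m + 1)) => (b, x)) ⁻¹'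
      {p | ∃ i, p.2 - p.1 i ∈ A i} = (univ.pi fun i => {b | x - b ∈ A i}ᶜ)ᶜ := by
    ext b
    simp
  rw [hcompl, measure_compl (.univ_pi fun i => (hAx i).compl) (measure_ne_top _ _),
    Measure.pi_univ, Measure.pi_pi, ENNReal.mul_sub (fun _ _ => hP), mul_one,
    ← Finset.prod_mul_distrib]
  simp only [Measure.restrict_apply_univ]
  congr 1
  refine Finset.prod_congr rfl fun i _ => ?_
  have h1 : volume ({b | x - b ∈ A i} ∩ B i) = volume (B i) * coverProb (A i) (B i) x := by
    rw [coverProb, ENNReal.mul_div_cancel (hB0 i) (hB1 i), inter_comm]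
    rfl
  have h2 := measure_compl (μ := volume.restrict (B i)) (hAx i) (measure_ne_top _ _)
  rw [h2, Measure.restrict_apply_univ, Measure.restrict_apply (hAx i), h1,
    ENNReal.mul_sub (fun _ _ => hB1 i), mul_one]

lemma expUnion_eq_toReal_lintegral {m n : ℕ}
    {A B : Fin n → Set (EuclideanSpace ℝ (Fin (m + 1)))} (hA : ∀ i, MeasurableSet (A i))
    (hB0 : ∀ i, volume (B i) ≠ 0) (hB1 : ∀ i, volume (B i) ≠ ∞) :
    expUnion A B = (∫⁻ x, (1 - ∏ i, (1 - coverProb (A i) (B i) x))).toReal := by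
  rw [expUnion, lintegral_volume_iUnion_translates hA hB0 hB1, ← mul_assoc,
    ENNReal.inv_mul_cancel (Finset.prod_ne_zero_iff.2 fun i _ => hB0 i)
      (ENNReal.prod_ne_top fun i _ => hB1 i), one_mul]

end

theorem stmt13 (d n : ℕ) (hd : 1 ≤ d) (hn : 1 ≤ n)
    (A B : Fin n → Set (EuclideanSpace ℝ (Fin d)))
    (hAm : ∀ i, MeasurableSet (A i)) (hBm : ∀ i, MeasurableSet (B i))
    (hA0 : ∀ i, 0 < volume (A i)) (hA1 : ∀ i, volume (A i) < ⊤)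
    (hB0 : ∀ i, 0 < volume (B i)) (hB1 : ∀ i, volume (B i) < ⊤)
    (r s : Fin n → ℝ) (hr : ∀ i, 0 ≤ r i) (hs : ∀ i, 0 ≤ s i)
    (hvA : ∀ i, volume (Metric.closedBall (0 : EuclideanSpace ℝ (Fin d)) (r i)) = volume (A i))
    (hvB : ∀ i, volume (Metric.closedBall (0 : EuclideanSpace ℝ (Fin d)) (s i)) = volume (B i)) :
    expUnion A B ≥
      expUnion (fun i => Metric.closedBall (0 : EuclideanSpace ℝ (Fin d)) (r i))
        (fun i => Metric.closedBall 0 (s i)) := by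
  obtain ⟨m, rfl⟩ : ∃ m, d = m + 1 := ⟨d - 1, by omega⟩
  rw [ge_iff_le,
    expUnion_eq_toReal_lintegral hAm (fun i => (hB0 i).ne') (fun i => (hB1 i).ne),
    expUnion_eq_toReal_lintegral (fun i => measurableSet_closedBall)
      (fun i => by rw [hvB]; exact (hB0 i).ne')
      (fun i => by rw [hvB]; exact (hB1 i).ne)]
  have h := LessConcentrated.one_sub_prod Finset.univ fun i =>
    lessConcentrated_coverProb (hAm i) (hBm i) (hA1 i).ne (hB0 i).ne' (hB1 i).ne (hvA i) (hvB i)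
  exact ENNReal.toReal_mono h.left_ne_top h.lintegral_le_lintegral
end
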